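/- arXiv:1911.01790 — 4 statements merged into one kernel-verified Lean document; each statement's English description precedes it below -/
import Mathlib

section
/- Let p > 3 be a prime. Then sum_{n=0}^{(p-1)/2} (3n+1)/(-8)^n * C(2n,n)^3 ≡ p*(-1|p) + (p^3/4)*(2|p)*E_{p-3}(1/4) (mod p^4), where the congruence is between rational numbers whose denominators are coprime to p (i.e., the difference has p-adic valuation at least 4). -/
/-- The `n`-th Euler polynomial evaluated at `x`, via the standard closed form
`E_n(x) = ∑_{k=0}^n 2^{-k} ∑_{j=0}^k (-1)^j C(k,j) (x+j)^n`,
which agrees with the generating function definition `2e^{xt}/(e^t+1) = ∑ E_n(x) tⁿ/n!`. -/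
def eulerE (n : ℕ) (x : ℚ) : ℚ :=
  ∑ k ∈ Finset.range (n + 1), (1 / 2 ^ k) *
    ∑ j ∈ Finset.range (k + 1), (-1) ^ j * (k.choose j) * (x + j) ^ n

open Finset

lemma neg_one_pow_sq_eq_one (n : ℕ) : ((-1 : ℚ) ^ n) ^ 2 = 1 := by
  rw [← pow_mul, mul_comm, pow_mul]
  norm_num

/-- The generalized binomial coefficient `C(y, k)` at a rational number `y`. -/
def ratChoose (y : ℚ) (k : ℕ) : ℚ := ∏ i ∈ range k, (y - i) / (i + 1)

lemma ratChoose_zero (y : ℚ) : ratChoose y 0 = 1 := by simp [ratChoose]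

lemma ratChoose_succ (y : ℚ) (k : ℕ) :
    ratChoose y (k + 1) = ratChoose y k * ((y - k) / (k + 1)) := by
  rw [ratChoose, prod_range_succ, ← ratChoose]

lemma ratChoose_add_one_succ (y : ℚ) (k : ℕ) :
    ratChoose (y + 1) (k + 1) = ratChoose y k * ((y + 1) / (k + 1)) := by
  induction k with
  | zero => simp [ratChoose]
  | succ k ih =>
    rw [ratChoose_succ, ih, ratChoose_succ]
    push_cast
    field_simp
    ring

lemma ratChoose_add_one_mul (y : ℚ) (k : ℕ) :
    ratChoose (y + 1) k * (y + 1 - k) = ratChoose y k * (y + 1) := by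
  have h := ratChoose_add_one_succ y k
  rw [ratChoose_succ] at h
  field_simp at h
  linarith

lemma sum_sub_two_mul_ratChoose_cube (y : ℚ) (K : ℕ) :
    ∑ k ∈ range (K + 1),
        ((y + 1 - 2 * k) * ratChoose (y + 1) k ^ 3 + (y - 2 * k) * ratChoose y k ^ 3) =
      (2 * y + 1 - K) * ratChoose y K ^ 3 := by
  induction K with
  | zero => simp [ratChoose]; ring
  | succ K ih =>
    rw [sum_range_succ, ih, ratChoose_add_one_succ, ratChoose_succ]
    push_cast
    field_simp
    ring

lemma ratChoose_add_half_middle (M : ℕ) :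
    ratChoose (2 * M + 1 / 2) M = (2 * M + 1).centralBinom / 2 ^ (2 * M + 1) ∧
      ratChoose (2 * M + 3 / 2) (M + 1) = (2 * M + 2).centralBinom / 2 ^ (2 * M + 2) := by
  have key (n : ℕ) : ((n + 1).centralBinom : ℚ) = 2 * (2 * n + 1) / (n + 1) * n.centralBinom := by
    have h := Nat.succ_mul_centralBinom_succ n
    have h' : ((n : ℚ) + 1) * (n + 1).centralBinom = 2 * (2 * n + 1) * n.centralBinom := by
      exact_mod_cast h
    field_simp
    linarith
  have step (M : ℕ)
      (h : ratChoose (2 * M + 1 / 2) M = (2 * M + 1).centralBinom / 2 ^ (2 * M + 1)) :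
      ratChoose (2 * M + 3 / 2) (M + 1) = (2 * M + 2).centralBinom / 2 ^ (2 * M + 2) := by
    have e : (2 * M + 3 / 2 : ℚ) = 2 * M + 1 / 2 + 1 := by ring
    rw [e, ratChoose_add_one_succ, h, key (2 * M + 1)]
    push_cast
    field_simp
    ring
  induction M with
  | zero =>
    have h0 : ratChoose (2 * (0 : ℕ) + 1 / 2) 0 =
        (2 * 0 + 1).centralBinom / 2 ^ (2 * 0 + 1) := by
      norm_num [ratChoose, Nat.centralBinom_eq_two_mul_choose]
    exact ⟨h0, step 0 h0⟩
  | succ M ih =>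
    have h1 : ratChoose (2 * (M + 1 : ℕ) + 1 / 2) (M + 1) =
        (2 * (M + 1) + 1).centralBinom / 2 ^ (2 * (M + 1) + 1) := by
      have h := ratChoose_add_one_mul (2 * M + 3 / 2) (M + 1)
      have e : (2 * (M + 1 : ℕ) + 1 / 2 : ℚ) = 2 * M + 3 / 2 + 1 := by push_cast; ring
      have hk := key (2 * M + 2)
      rw [ih.2] at h
      rw [e, show 2 * (M + 1) + 1 = 2 * M + 2 + 1 by ring, hk]
      push_cast at h ⊢
      have h3 : (2 * M + 3 / 2 + 1 - (M + 1) : ℚ) ≠ 0 := by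
        have : (0 : ℚ) ≤ M := by positivity
        intro h; linarith
      apply mul_right_cancel₀ h3
      rw [h]
      field_simp
      ring
    exact ⟨h1, step _ h1⟩

lemma sum_three_mul_add_one_eq_sum_ratChoose (N : ℕ) :
    ∑ n ∈ range (N + 1), (3 * (n : ℚ) + 1) / (-8) ^ n * ((2 * n).choose n : ℚ) ^ 3 =
      2 * (-1) ^ N *
        ∑ k ∈ range (N / 2 + 1), (N + 1 / 2 - 2 * k) * ratChoose (N + 1 / 2) k ^ 3 := by
  induction N with
  | zero => simp [ratChoose]
  | succ N ih =>
    rw [sum_range_succ, ih, ← Nat.centralBinom_eq_two_mul_choose]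
    have hterm (c : ℚ) : (3 * ((N + 1 : ℕ) : ℚ) + 1) / (-8) ^ (N + 1) * c ^ 3 =
        -(-1) ^ N * ((3 * N + 4) * (c / 2 ^ (N + 1)) ^ 3) := by
      have h8 : (-8 : ℚ) ^ (N + 1) = (-1) ^ (N + 1) * (2 ^ (N + 1)) ^ 3 := by
        rw [← pow_mul, mul_comm (N + 1) 3, pow_mul, ← mul_pow]; norm_num
      have hs : ((-1 : ℚ) ^ N) ^ 2 = 1 := neg_one_pow_sq_eq_one N
      have hs0 : (-1 : ℚ) ^ N ≠ 0 := by positivity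
      rw [h8, pow_succ (-1 : ℚ) N]
      push_cast
      field_simp
      linear_combination (3 * N + 4) * c ^ 3 * hs
    rw [hterm, pow_succ]
    obtain ⟨M, hM | hM⟩ := Nat.even_or_odd' N
    · have hN : (N : ℚ) = 2 * M := by subst hM; push_cast; ring
      have hc : ratChoose (N + 1 / 2) M = (N + 1).centralBinom / 2 ^ (N + 1) := by
        rw [hN, (ratChoose_add_half_middle M).1, hM]
      have ht := sum_sub_two_mul_ratChoose_cube (N + 1 / 2) M
      have hy : ((N + 1 : ℕ) : ℚ) + 1 / 2 = N + 1 / 2 + 1 := by push_cast; ring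
      rw [sum_add_distrib] at ht
      rw [show N / 2 = M by omega, show (N + 1) / 2 = M by omega, ← hc, hy]
      linear_combination 2 * (-1 : ℚ) ^ N * ht +
        (-1 : ℚ) ^ N * ratChoose (N + 1 / 2) M ^ 3 * hN
    · have hN : (N : ℚ) = 2 * M + 1 := by subst hM; push_cast; ring
      have hc : ratChoose (N + 1 / 2) (M + 1) = (N + 1).centralBinom / 2 ^ (N + 1) := by
        rw [hN, show (2 * M + 1 + 1 / 2 : ℚ) = 2 * M + 3 / 2 by ring,
          (ratChoose_add_half_middle M).2, hM]
      have ht := sum_sub_two_mul_ratChoose_cube (N + 1 / 2) (M + 1)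
      have hy : ((N + 1 : ℕ) : ℚ) + 1 / 2 = N + 1 / 2 + 1 := by push_cast; ring
      rw [sum_add_distrib, sum_range_succ (fun k : ℕ =>
        ((N : ℚ) + 1 / 2 - 2 * k) * ratChoose (N + 1 / 2) k ^ 3)] at ht
      push_cast at ht
      rw [show N / 2 = M by omega, show (N + 1) / 2 = M + 1 by omega, ← hc, hy]
      linear_combination 2 * (-1 : ℚ) ^ N * ht -
        (-1 : ℚ) ^ N * ratChoose (N + 1 / 2) (M + 1) ^ 3 * hN

lemma eulerE_add_one_add (n : ℕ) (x : ℚ) : eulerE n (x + 1) + eulerE n x = 2 * x ^ n := by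
  set d : ℕ → ℚ → ℚ := fun k x =>
    ∑ j ∈ range (k + 1), (-1) ^ j * (k.choose j) * (x + j) ^ n with hd
  have hdiff (k : ℕ) (x : ℚ) :
      d k x = (-1) ^ k * (fwdDiff 1)^[k] (fun r : ℚ => r ^ n) x := by
    rw [fwdDiff_iter_eq_sum_shift, mul_sum]
    refine sum_congr rfl fun j hj => ?_
    have hj' : j ≤ k := by simpa [Nat.lt_succ_iff] using hj
    have hsign : (-1 : ℚ) ^ k * (-1) ^ (k - j) = (-1) ^ j := by
      obtain ⟨i, rfl⟩ := Nat.exists_eq_add_of_le hj'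
      rw [Nat.add_sub_cancel_left, pow_add, mul_assoc, ← mul_pow]
      norm_num
    rw [← hsign]
    simp
    ring
  have hsucc (k : ℕ) : d (k + 1) x = d k x - d k (x + 1) := by
    rw [hdiff, hdiff, hdiff, Function.iterate_succ_apply', fwdDiff]
    ring
  have hzero : d (n + 1) x = 0 := by
    rw [hdiff, fwdDiff_iter_pow_eq_zero_of_lt (Nat.lt_succ_self n)]
    simp
  have hpart (m : ℕ) : ∑ k ∈ range m, (1 / 2 ^ k) * d k (x + 1) +
      ∑ k ∈ range m, (1 / 2 ^ k) * d k x = 2 * x ^ n - 2 * (1 / 2 ^ m) * d m x := by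
    induction m with
    | zero => simp [hd]
    | succ m ih =>
      rw [sum_range_succ, sum_range_succ, hsucc, pow_succ]
      field_simp at ih ⊢
      linear_combination ih
  have h := hpart (n + 1)
  rw [hzero, mul_zero, sub_zero] at h
  exact h

lemma eulerE_add_nat (n : ℕ) (x : ℚ) (m : ℕ) :
    eulerE n (x + m) =
      (-1) ^ m * (eulerE n x - 2 * ∑ k ∈ range m, (-1) ^ k * (x + k) ^ n) := by
  induction m with
  | zero => simp
  | succ m ih =>
    have h := eulerE_add_one_add n (x + m)
    have hs : ((-1 : ℚ) ^ m) ^ 2 = 1 := neg_one_pow_sq_eq_one m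
    rw [Nat.cast_succ, ← add_assoc, sum_range_succ, pow_succ]
    linear_combination h - ih - 2 * (x + m) ^ n * hs

/-- The rational numbers of `p`-adic valuation at least `s`. -/
def padicMultiples (p : ℕ) [Fact p.Prime] (s : ℕ) : AddSubgroup ℚ where
  carrier := {x | padicNorm p x ≤ (p : ℚ) ^ (-s : ℤ)}
  zero_mem' := by
    change padicNorm p 0 ≤ _
    rw [padicNorm.zero]
    positivity
  add_mem' hx hy := padicNorm.nonarchimedean.trans (max_le hx hy)
  neg_mem' hx := by simpa [padicNorm.neg] using hx

section padicMultiples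

variable {p : ℕ} [Fact p.Prime] {s t : ℕ} {x y : ℚ}

lemma not_dvd_two_pow (hp : p ≠ 2) (n : ℕ) : ¬ p ∣ 2 ^ n := fun h =>
  hp ((Nat.prime_dvd_prime_iff_eq Fact.out Nat.prime_two).1
    ((Fact.out : p.Prime).dvd_of_dvd_pow h))

lemma mem_padicMultiples : x ∈ padicMultiples p s ↔ padicNorm p x ≤ (p : ℚ) ^ (-s : ℤ) := Iff.rfl

lemma mul_mem_padicMultiples {r : ℕ} (hx : x ∈ padicMultiples p s) (hy : y ∈ padicMultiples p t)
    (h : s + t = r) : x * y ∈ padicMultiples p r := by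
  subst h
  have hp : (p : ℚ) ≠ 0 := Nat.cast_ne_zero.2 (Fact.out : p.Prime).ne_zero
  rw [mem_padicMultiples] at *
  rw [padicNorm.mul, Nat.cast_add, neg_add, zpow_add₀ hp]
  exact mul_le_mul hx hy (padicNorm.nonneg _) (by positivity)

lemma padicMultiples_antitone (h : t ≤ s) (hx : x ∈ padicMultiples p s) :
    x ∈ padicMultiples p t := by
  have hp : (1 : ℚ) ≤ p := by exact_mod_cast (Fact.out : p.Prime).one_le
  rw [mem_padicMultiples] at *
  exact hx.trans (zpow_le_zpow_right₀ hp (by omega))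

lemma mul_mem_padicMultiples_right (hx : x ∈ padicMultiples p s) (hy : y ∈ padicMultiples p 0) :
    x * y ∈ padicMultiples p s :=
  mul_mem_padicMultiples hx hy (add_zero s)

lemma mul_mem_padicMultiples_left (hx : x ∈ padicMultiples p 0) (hy : y ∈ padicMultiples p s) :
    x * y ∈ padicMultiples p s :=
  mul_mem_padicMultiples hx hy (zero_add s)

lemma intCast_mem_padicMultiples (z : ℤ) : (z : ℚ) ∈ padicMultiples p 0 := by
  simpa [mem_padicMultiples] using padicNorm.of_int (p := p) z

lemma natCast_mem_padicMultiples (n : ℕ) : (n : ℚ) ∈ padicMultiples p 0 := by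
  exact_mod_cast intCast_mem_padicMultiples (p := p) n

lemma neg_one_pow_mem_padicMultiples (n : ℕ) : (-1 : ℚ) ^ n ∈ padicMultiples p 0 := by
  exact_mod_cast intCast_mem_padicMultiples (p := p) ((-1) ^ n)

lemma inv_natCast_mem_padicMultiples {n : ℕ} (h : ¬ p ∣ n) :
    (n : ℚ)⁻¹ ∈ padicMultiples p 0 := by
  rw [mem_padicMultiples, ← one_div, padicNorm.div, (padicNorm.nat_eq_one_iff n).2 h]
  simp

lemma prime_mem_padicMultiples : (p : ℚ) ∈ padicMultiples p 1 := by
  simp [mem_padicMultiples, padicNorm.padicNorm_p_of_prime]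

lemma pow_mem_padicMultiples (hx : x ∈ padicMultiples p s) (n : ℕ) :
    x ^ n ∈ padicMultiples p (s * n) := by
  induction n with
  | zero => simpa using natCast_mem_padicMultiples (p := p) 1
  | succ n ih => rw [pow_succ]; exact mul_mem_padicMultiples ih hx (Nat.mul_succ s n).symm

lemma pow_sub_pow_mem_padicMultiples (hx : x ∈ padicMultiples p 0) (hy : y ∈ padicMultiples p 0)
    (h : x - y ∈ padicMultiples p s) (n : ℕ) : x ^ n - y ^ n ∈ padicMultiples p s := by
  induction n with
  | zero => simp
  | succ n ih =>
    rw [show x ^ (n + 1) - y ^ (n + 1) = (x ^ n - y ^ n) * x + y ^ n * (x - y) by ring]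
    refine add_mem (mul_mem_padicMultiples_right ih hx) (mul_mem_padicMultiples_left ?_ h)
    simpa using pow_mem_padicMultiples hy n

lemma pow_dvd_num_of_mem_padicMultiples (h : x ∈ padicMultiples p s) : (p : ℤ) ^ s ∣ x.num := by
  have h' := padicNorm.dvd_iff_norm_le (p := p) (n := s) (z := x.num)
  push_cast at h'
  rw [h', ← mem_padicMultiples, ← Rat.mul_den_eq_num x]
  exact mul_mem_padicMultiples_right h (natCast_mem_padicMultiples _)

lemma eulerE_sub_mem_padicMultiples (hp : p ≠ 2) (hx : x ∈ padicMultiples p 0)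
    (hy : y ∈ padicMultiples p 0) (h : x - y ∈ padicMultiples p s) (n : ℕ) :
    eulerE n x - eulerE n y ∈ padicMultiples p s := by
  have hp2 : ¬ p ∣ 2 := not_dvd_two_pow hp 1
  rw [eulerE, eulerE, ← sum_sub_distrib]
  refine sum_mem fun k _ => ?_
  rw [← mul_sub, ← sum_sub_distrib]
  refine mul_mem_padicMultiples_left ?_ (sum_mem fun j _ => ?_)
  · rw [one_div, ← inv_pow]
    simpa using pow_mem_padicMultiples (inv_natCast_mem_padicMultiples hp2) k
  · rw [← mul_sub]
    refine mul_mem_padicMultiples_left ?_ (pow_sub_pow_mem_padicMultiples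
      (add_mem hx (natCast_mem_padicMultiples j)) (add_mem hy (natCast_mem_padicMultiples j))
      (by simpa using h) n)
    exact_mod_cast intCast_mem_padicMultiples (p := p) ((-1) ^ j * k.choose j)

lemma mem_of_two_mul_mem_padicMultiples (hp : p ≠ 2) (h : 2 * x ∈ padicMultiples p s) :
    x ∈ padicMultiples p s := by
  have hp2 : ¬ p ∣ 2 := not_dvd_two_pow hp 1
  have := mul_mem_padicMultiples_left (inv_natCast_mem_padicMultiples hp2) h
  simpa using this

lemma eulerE_zero_mem_padicMultiples (hp : p ≠ 2) {n : ℕ} (hn : Even n) (hn0 : n ≠ 0) :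
    eulerE n 0 ∈ padicMultiples p 1 := by
  have hodd : Odd p := (Fact.out : p.Prime).odd_of_ne_two hp
  have h0 : (0 : ℚ) ∈ padicMultiples p 0 := zero_mem _
  have h1 : (1 : ℚ) ∈ padicMultiples p 0 := by
    simpa using natCast_mem_padicMultiples (p := p) 1
  have hshift := eulerE_add_nat n 0 (p + 1)
  have hone := eulerE_add_one_add n 0
  have hcong : eulerE n (0 + (p + 1 : ℕ)) - eulerE n (0 + 1) ∈ padicMultiples p 1 := by
    refine eulerE_sub_mem_padicMultiples hp ?_ (add_mem h0 h1) ?_ n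
    · simpa using natCast_mem_padicMultiples (p := p) (p + 1)
    · simpa using prime_mem_padicMultiples
  have hsum : 2 * ∑ k ∈ range (p + 1), (-1 : ℚ) ^ k * (0 + k) ^ n ∈ padicMultiples p 1 := by
    have hr := sum_range_reflect (fun k : ℕ => (-1 : ℚ) ^ k * (0 + k) ^ n) (p + 1)
    rw [two_mul]
    nth_rewrite 1 [← hr]
    rw [← sum_add_distrib]
    refine sum_mem fun k hk => ?_
    have hk' : k ≤ p := by simpa [Nat.lt_succ_iff] using hk
    have hsign : (-1 : ℚ) ^ (p - k) = -(-1) ^ k := by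
      have := hodd.neg_one_pow (α := ℚ)
      obtain ⟨i, hi⟩ := Nat.exists_eq_add_of_le hk'
      rw [hi] at this
      rw [hi, Nat.add_sub_cancel_left]
      rw [pow_add] at this
      rcases neg_one_pow_eq_or ℚ k with h | h <;> rw [h] at this ⊢ <;> linarith
    rw [show p + 1 - 1 - k = p - k by omega, hsign, Nat.cast_sub hk',
      show -(-1 : ℚ) ^ k * (0 + (p - k)) ^ n + (-1) ^ k * (0 + k) ^ n =
        (-1) ^ k * ((-(k : ℚ)) ^ n - (p - k) ^ n) by rw [hn.neg_pow]; ring]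
    refine mul_mem_padicMultiples_left (neg_one_pow_mem_padicMultiples k) ?_
    refine pow_sub_pow_mem_padicMultiples (neg_mem (natCast_mem_padicMultiples k))
      (by exact_mod_cast intCast_mem_padicMultiples (p := p) (p - k)) ?_ n
    rw [show -(k : ℚ) - (p - k) = -p by ring]
    exact neg_mem prime_mem_padicMultiples
  refine mem_of_two_mul_mem_padicMultiples hp ?_
  rw [hshift, (hodd.add_one).neg_one_pow] at hcong
  rw [zero_pow hn0] at hone
  convert add_mem hcong hsum using 1
  linear_combination hone

lemma eulerE_one_div_four_sub_mem_padicMultiples (hp : p ≠ 2) {n : ℕ} (hn : Even n)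
    (hn0 : n ≠ 0) :
    eulerE n (1 / 4) - 2 * (-1) ^ (p / 4) *
      ∑ k ∈ range (p / 4), (-1) ^ (k + 1) * ((k : ℚ) + 1) ^ n ∈ padicMultiples p 1 := by
  have hodd : p % 2 = 1 := Nat.odd_iff.1 ((Fact.out : p.Prime).odd_of_ne_two hp)
  have hp4 : ¬ p ∣ 4 := not_dvd_two_pow hp 2
  have hinv : (1 / 4 : ℚ) ∈ padicMultiples p 0 := by
    simpa using inv_natCast_mem_padicMultiples hp4
  have hquarter : (p : ℚ) * (1 / 4) ∈ padicMultiples p 1 :=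
    mul_mem_padicMultiples_right prime_mem_padicMultiples hinv
  have hE := eulerE_zero_mem_padicMultiples hp hn hn0
  have hpow := neg_one_pow_mem_padicMultiples (p := p)
  set M := p / 4
  have hs : ((-1 : ℚ) ^ M) ^ 2 = 1 := neg_one_pow_sq_eq_one M
  have hdiv : p = 4 * M + 1 ∨ p = 4 * M + 3 := by omega
  rcases hdiv with h | h
  · have hM : (p : ℚ) = 4 * M + 1 := by exact_mod_cast h
    have hcong := eulerE_sub_mem_padicMultiples (s := 1) hp hinv
      (neg_mem (natCast_mem_padicMultiples (p := p) M))
      (by rw [show (1 / 4 - -M : ℚ) = p * (1 / 4) by rw [hM]; ring]; exact hquarter) n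
    have hshift := eulerE_add_nat n (-M : ℚ) M
    rw [neg_add_cancel] at hshift
    have hr := sum_range_reflect (fun k : ℕ => (-1 : ℚ) ^ k * (-M + k) ^ n) M
    have hsum : ∑ k ∈ range M, (-1 : ℚ) ^ k * (-M + k) ^ n =
        (-1) ^ M * ∑ k ∈ range M, (-1) ^ (k + 1) * ((k : ℚ) + 1) ^ n := by
      rw [← hr, mul_sum]
      refine sum_congr rfl fun k hk => ?_
      have hk' := mem_range.1 hk
      obtain ⟨i, hi⟩ := Nat.exists_eq_add_of_lt hk'
      have hi1 : M - 1 - k = i := by omega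
      have hiM : (M : ℚ) = k + i + 1 := by exact_mod_cast hi
      rw [hi1, hiM, show (-((k : ℚ) + i + 1) + i) = -(k + 1) by ring, hn.neg_pow, hi]
      ring_nf
      rw [show k * 2 = 2 * k by ring, pow_mul]
      norm_num
    rw [hsum] at hshift
    convert add_mem hcong (mul_mem_padicMultiples_left (hpow M) hE) using 1
    rw [hshift]
    linear_combination (2 * (-1) ^ M * (∑ k ∈ range M, (-1) ^ (k + 1) * ((k : ℚ) + 1) ^ n) -
      eulerE n (-M)) * hs
  · have hM : (p : ℚ) = 4 * M + 3 := by exact_mod_cast h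
    have hcong := eulerE_sub_mem_padicMultiples (s := 1) hp hinv
      (add_mem (zero_mem _) (natCast_mem_padicMultiples (p := p) (M + 1)))
      (by
        rw [show (1 / 4 - (0 + (M + 1 : ℕ)) : ℚ) = -(p * (1 / 4)) by rw [hM]; push_cast; ring]
        exact neg_mem hquarter) n
    rw [eulerE_add_nat, sum_range_succ'] at hcong
    have hm := mul_mem_padicMultiples_left (hpow (M + 1)) hE
    convert add_mem hcong hm using 1
    simp only [Nat.cast_add, Nat.cast_one, Nat.cast_zero, zero_add, zero_pow hn0, mul_zero,
      add_zero]
    ring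

lemma inv_sq_sub_pow_mem_padicMultiples (hp : 3 < p) {a : ℕ} (ha : ¬ p ∣ a) :
    ((a : ℚ) ^ 2)⁻¹ - (a : ℚ) ^ (p - 3) ∈ padicMultiples p 1 := by
  have ha0 : (a : ℚ) ≠ 0 := by rintro h; apply ha; simp [Nat.cast_eq_zero.1 h]
  have hf : (p : ℤ) ∣ 1 - (a : ℤ) ^ (p - 1) := by
    refine (Int.ModEq.pow_card_sub_one_eq_one Fact.out ?_).dvd
    exact Nat.isCoprime_iff_coprime.2 (((Fact.out : p.Prime).coprime_iff_not_dvd.2 ha).symm)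
  obtain ⟨c, hc⟩ := hf
  have hc' : (1 : ℚ) - (a : ℚ) ^ (p - 1) = p * c := by exact_mod_cast hc
  have hpow : (a : ℚ) ^ (p - 1) = a ^ (p - 3) * a ^ 2 := by rw [← pow_add]; congr 1; omega
  have e : ((a : ℚ) ^ 2)⁻¹ - (a : ℚ) ^ (p - 3) = p * c * ((a : ℚ)⁻¹) ^ 2 := by
    rw [← hc', hpow]; field_simp
  rw [e]
  refine mul_mem_padicMultiples_right (mul_mem_padicMultiples_right prime_mem_padicMultiples
    (intCast_mem_padicMultiples c)) ?_
  simpa using pow_mem_padicMultiples (inv_natCast_mem_padicMultiples ha) 2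

lemma ratChoose_half_sub_mem_padicMultiples (hp : p ≠ 2) {k : ℕ} (hk : k + 1 < p) :
    ratChoose (p / 2) (k + 1) - p / 2 * ((-1) ^ k / (k + 1)) ∈ padicMultiples p 2 := by
  have hp2 : ¬ p ∣ 2 := not_dvd_two_pow hp 1
  have hhalf : (p : ℚ) / 2 ∈ padicMultiples p 1 :=
    mul_mem_padicMultiples_right prime_mem_padicMultiples (inv_natCast_mem_padicMultiples hp2)
  have hinv (m : ℕ) (hm : m + 1 < p) : ((m : ℚ) + 1)⁻¹ ∈ padicMultiples p 0 := by
    exact_mod_cast inv_natCast_mem_padicMultiples (Nat.not_dvd_of_pos_of_lt m.succ_pos hm)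
  have hpow := neg_one_pow_mem_padicMultiples (p := p)
  induction k with
  | zero => simp [ratChoose]
  | succ k ih =>
    have ih := ih (by omega)
    have hchoose : ratChoose (p / 2) (k + 1) ∈ padicMultiples p 1 := by
      rw [← sub_add_cancel (ratChoose (p / 2) (k + 1)) (p / 2 * ((-1) ^ k / (k + 1)))]
      exact add_mem (padicMultiples_antitone one_le_two ih) (mul_mem_padicMultiples_right hhalf
        (mul_mem_padicMultiples_right (hpow k) (hinv k (by omega))))
    have hi := hinv (k + 1) hk
    rw [ratChoose_succ]
    have e : ratChoose (p / 2) (k + 1) * ((p / 2 - (k + 1 : ℕ)) / ((k + 1 : ℕ) + 1)) -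
        p / 2 * ((-1) ^ (k + 1) / ((k + 1 : ℕ) + 1)) =
        ratChoose (p / 2) (k + 1) * (p / 2) * (((k + 1 : ℕ) : ℚ) + 1)⁻¹ -
        (ratChoose (p / 2) (k + 1) - p / 2 * ((-1) ^ k / (k + 1))) *
          ((k + 1 : ℕ) * (((k + 1 : ℕ) : ℚ) + 1)⁻¹) := by
      push_cast
      field_simp
      ring
    rw [e]
    exact sub_mem (mul_mem_padicMultiples_right (mul_mem_padicMultiples hchoose hhalf rfl) hi)
      (mul_mem_padicMultiples_right ih
        (mul_mem_padicMultiples_right (natCast_mem_padicMultiples _) hi))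

lemma sub_mul_ratChoose_half_cube_sub_mem_padicMultiples (hp : p ≠ 2) {k : ℕ} (hk : k + 1 < p) :
    (p - 4 * ((k : ℚ) + 1)) * ratChoose (p / 2) (k + 1) ^ 3 -
      p ^ 3 / 2 * ((-1) ^ (k + 1) * (((k : ℚ) + 1) ^ 2)⁻¹) ∈ padicMultiples p 4 := by
  have hp2 : ¬ p ∣ 2 := not_dvd_two_pow hp 1
  have hhalf : (p : ℚ) / 2 ∈ padicMultiples p 1 :=
    mul_mem_padicMultiples_right prime_mem_padicMultiples (inv_natCast_mem_padicMultiples hp2)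
  have hinv : ((k : ℚ) + 1)⁻¹ ∈ padicMultiples p 0 := by
    exact_mod_cast inv_natCast_mem_padicMultiples (Nat.not_dvd_of_pos_of_lt k.succ_pos hk)
  have hpow := neg_one_pow_mem_padicMultiples (p := p) k
  have hsub := ratChoose_half_sub_mem_padicMultiples hp hk
  set u := ratChoose (p / 2) (k + 1)
  set v : ℚ := p / 2 * ((-1) ^ k / (k + 1)) with hv
  have hv1 : v ∈ padicMultiples p 1 :=
    mul_mem_padicMultiples_right hhalf (mul_mem_padicMultiples_right hpow hinv)
  have hu1 : u ∈ padicMultiples p 1 := by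
    rw [← sub_add_cancel u v]
    exact add_mem (padicMultiples_antitone one_le_two hsub) hv1
  have hv3 : -4 * ((k : ℚ) + 1) * v ^ 3 =
      p ^ 3 / 2 * ((-1) ^ (k + 1) * (((k : ℚ) + 1) ^ 2)⁻¹) := by
    have hs : ((-1 : ℚ) ^ k) ^ 2 = 1 := neg_one_pow_sq_eq_one k
    rw [hv, pow_succ]
    field_simp
    linear_combination (-4) * (p : ℚ) ^ 3 * (-1 : ℚ) ^ k * hs
  have hz : -4 * ((k : ℚ) + 1) ∈ padicMultiples p 0 := by
    exact_mod_cast intCast_mem_padicMultiples (p := p) (-4 * (k + 1))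
  rw [← hv3, show (p - 4 * ((k : ℚ) + 1)) * u ^ 3 - -4 * ((k : ℚ) + 1) * v ^ 3 =
    p * u ^ 3 + -4 * ((k : ℚ) + 1) * ((u - v) * (u * u + u * v + v * v)) by ring]
  exact add_mem (mul_mem_padicMultiples prime_mem_padicMultiples (pow_mem_padicMultiples hu1 3) rfl)
    (mul_mem_padicMultiples_left hz (mul_mem_padicMultiples hsub
      (add_mem (add_mem (mul_mem_padicMultiples hu1 hu1 rfl) (mul_mem_padicMultiples hu1 hv1 rfl))
        (mul_mem_padicMultiples hv1 hv1 rfl)) rfl))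

lemma sum_three_mul_add_one_sub_mem_padicMultiples (hp : p ≠ 2) :
    ∑ n ∈ range ((p - 1) / 2 + 1),
        (3 * (n : ℚ) + 1) / (-8) ^ n * ((2 * n).choose n : ℚ) ^ 3 -
      (-1) ^ (p / 2) * ((p : ℚ) + p ^ 3 / 2 *
        ∑ k ∈ range (p / 4), (-1) ^ (k + 1) * (((k : ℚ) + 1) ^ 2)⁻¹) ∈ padicMultiples p 4 := by
  have hodd : p % 2 = 1 := Nat.odd_iff.1 ((Fact.out : p.Prime).odd_of_ne_two hp)
  have hhalf : ((p / 2 : ℕ) : ℚ) + 1 / 2 = p / 2 := by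
    have : (p : ℚ) = 2 * (p / 2 : ℕ) + 1 := by
      exact_mod_cast (show p = 2 * (p / 2) + 1 by omega)
    linarith
  have hpow := neg_one_pow_mem_padicMultiples (p := p) (p / 2)
  rw [sum_three_mul_add_one_eq_sum_ratChoose, show (p - 1) / 2 = p / 2 by omega, hhalf,
    Nat.div_div_eq_div_mul, sum_range_succ', ratChoose_zero]
  have hterms : ∑ k ∈ range (p / 4), ((p - 4 * ((k : ℚ) + 1)) * ratChoose (p / 2) (k + 1) ^ 3 -
      p ^ 3 / 2 * ((-1) ^ (k + 1) * (((k : ℚ) + 1) ^ 2)⁻¹)) ∈ padicMultiples p 4 :=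
    sum_mem fun k hk => sub_mul_ratChoose_half_cube_sub_mem_padicMultiples hp (by
      have := mem_range.1 hk
      omega)
  convert mul_mem_padicMultiples_left hpow hterms using 1
  rw [sum_sub_distrib, ← mul_sum]
  have hdouble : ∑ k ∈ range (p / 4), (p - 4 * ((k : ℚ) + 1)) * ratChoose (p / 2) (k + 1) ^ 3 =
      2 * ∑ k ∈ range (p / (2 * 2)),
        (p / 2 - 2 * ((k + 1 : ℕ) : ℚ)) * ratChoose (p / 2) (k + 1) ^ 3 := by
    rw [mul_sum]
    exact sum_congr rfl fun k _ => by push_cast; ring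
  rw [hdouble]
  push_cast
  ring

lemma legendreSym_neg_one_eq_neg_one_pow (hp : p ≠ 2) : legendreSym p (-1) = (-1) ^ (p / 2) := by
  rw [legendreSym.at_neg_one hp, ZMod.χ₄_eq_neg_one_pow
    (Nat.odd_iff.1 ((Fact.out : p.Prime).odd_of_ne_two hp))]

lemma legendreSym_two_eq_neg_one_pow (hp : p ≠ 2) :
    legendreSym p 2 = (-1) ^ (p / 2) * (-1) ^ (p / 4) := by
  have hodd : p % 2 = 1 := Nat.odd_iff.1 ((Fact.out : p.Prime).odd_of_ne_two hp)
  rw [legendreSym.at_two hp, ZMod.χ₈_nat_eq_if_mod_eight, ← pow_add, neg_one_pow_eq_pow_mod_two]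
  have h8 : p % 8 = 1 ∨ p % 8 = 3 ∨ p % 8 = 5 ∨ p % 8 = 7 := by omega
  rcases h8 with h | h | h | h
  · rw [show (p / 2 + p / 4) % 2 = 0 by omega]; simp [h, hodd]
  · rw [show (p / 2 + p / 4) % 2 = 1 by omega]; simp [h, hodd]
  · rw [show (p / 2 + p / 4) % 2 = 1 by omega]; simp [h, hodd]
  · rw [show (p / 2 + p / 4) % 2 = 0 by omega]; simp [h, hodd]

end padicMultiples

/-- Theorem 1.1 (Mao): for any prime `p > 3`,
`∑_{n=0}^{(p-1)/2} (3n+1)/(-8)^n C(2n,n)³ ≡ p(-1|p) + (p³/4)(2|p) E_{p-3}(1/4) (mod p⁴)`. -/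
theorem sum_three_n_add_one_div_neg_eight_pow (p : ℕ) [Fact (Nat.Prime p)] (hp : 3 < p) :
    ((p : ℤ)) ^ 4 ∣
      ((∑ n ∈ Finset.range ((p - 1) / 2 + 1),
          (3 * (n : ℚ) + 1) / (-8) ^ n * ((2 * n).choose n : ℚ) ^ 3) -
        ((p : ℚ) * (legendreSym p (-1) : ℚ) +
          (p : ℚ) ^ 3 / 4 * (legendreSym p 2 : ℚ) * eulerE (p - 3) (1 / 4))).num := by
  have hp2 : p ≠ 2 := by omega
  have hodd : p % 2 = 1 := Nat.odd_iff.1 ((Fact.out : p.Prime).odd_of_ne_two hp2)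
  have hp4 : ¬ p ∣ 4 := not_dvd_two_pow hp2 2
  apply pow_dvd_num_of_mem_padicMultiples
  have hS := sum_three_mul_add_one_sub_mem_padicMultiples hp2
  have hE := eulerE_one_div_four_sub_mem_padicMultiples hp2 (n := p - 3)
    (Nat.even_iff.2 (by omega)) (by omega)
  have hpow := neg_one_pow_mem_padicMultiples (p := p)
  have hF : ∑ k ∈ range (p / 4), (-1 : ℚ) ^ (k + 1) *
      ((((k : ℚ) + 1) ^ 2)⁻¹ - ((k : ℚ) + 1) ^ (p - 3)) ∈ padicMultiples p 1 := by
    refine sum_mem fun k hk => mul_mem_padicMultiples_left (hpow _) ?_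
    have hk' := mem_range.1 hk
    exact_mod_cast inv_sq_sub_pow_mem_padicMultiples hp
      (Nat.not_dvd_of_pos_of_lt k.succ_pos (show k + 1 < p by omega))
  simp only [mul_sub, sum_sub_distrib] at hF
  have hcube : (p : ℚ) ^ 3 * (4 : ℚ)⁻¹ ∈ padicMultiples p 3 :=
    mul_mem_padicMultiples_right (pow_mem_padicMultiples prime_mem_padicMultiples 3)
      (by exact_mod_cast inv_natCast_mem_padicMultiples hp4)
  have hF' := mul_mem_padicMultiples hcube (mul_mem_padicMultiples_left (hpow (p / 2))
    (add_mem hF hF)) rfl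
  have hE' := mul_mem_padicMultiples hcube (mul_mem_padicMultiples_left
    (mul_mem_padicMultiples_left (hpow (p / 2)) (hpow (p / 4))) hE) rfl
  have hs : ((-1 : ℚ) ^ (p / 4)) ^ 2 = 1 := neg_one_pow_sq_eq_one (p / 4)
  rw [legendreSym_neg_one_eq_neg_one_pow hp2, legendreSym_two_eq_neg_one_pow hp2]
  convert sub_mem (add_mem hS hF') hE' using 1
  push_cast
  linear_combination (-1 : ℚ) * (p : ℚ) ^ 3 / 2 * (-1) ^ (p / 2) *
    (∑ k ∈ range (p / 4), (-1) ^ (k + 1) * ((k : ℚ) + 1) ^ (p - 3)) * hs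
end

section
/- Let p > 3 be a prime and r > 0 an integer. Then sum_{n=0}^{p^r-1} (3n+1)/(-8)^n * C(2n,n)^3 ≡ (-1)^{(p^r-1)/2} * p^r (mod p^{r+2}), where the congruence is between rational numbers whose denominators are coprime to p. -/
/-- The rational number `x` is divisible by `p ^ s` in the ring of `p`-integral rationals. -/
def PadicDvd (p s : ℕ) (x : ℚ) : Prop :=
  ∃ a b : ℤ, ¬ (p : ℤ) ∣ b ∧ x * b = (p : ℚ) ^ s * a

namespace PadicDvd

variable {p s t : ℕ} {x y : ℚ}

theorem add (hp : p.Prime) (hx : PadicDvd p s x) (hy : PadicDvd p s y) :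
    PadicDvd p s (x + y) := by
  obtain ⟨a, b, hb, h⟩ := hx
  obtain ⟨c, d, hd, h'⟩ := hy
  refine ⟨a * d + c * b, b * d, (Nat.prime_iff_prime_int.mp hp).not_dvd_mul hb hd, ?_⟩
  push_cast
  linear_combination (d : ℚ) * h + (b : ℚ) * h'

theorem mul (hp : p.Prime) (hx : PadicDvd p s x) (hy : PadicDvd p t y) :
    PadicDvd p (s + t) (x * y) := by
  obtain ⟨a, b, hb, h⟩ := hx
  obtain ⟨c, d, hd, h'⟩ := hy
  refine ⟨a * c, b * d, (Nat.prime_iff_prime_int.mp hp).not_dvd_mul hb hd, ?_⟩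
  push_cast
  linear_combination (y * d) * h + ((p : ℚ) ^ s * a) * h'

theorem neg (hx : PadicDvd p s x) : PadicDvd p s (-x) := by
  obtain ⟨a, b, hb, h⟩ := hx
  refine ⟨-a, b, hb, ?_⟩
  push_cast
  linear_combination -h

theorem sub (hp : p.Prime) (hx : PadicDvd p s x) (hy : PadicDvd p s y) :
    PadicDvd p s (x - y) := by
  rw [sub_eq_add_neg]
  exact hx.add hp hy.neg

theorem mono (h : t ≤ s) (hx : PadicDvd p s x) : PadicDvd p t x := by
  obtain ⟨a, b, hb, e⟩ := hx
  obtain ⟨k, rfl⟩ := Nat.exists_eq_add_of_le h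
  refine ⟨p ^ k * a, b, hb, ?_⟩
  push_cast
  rw [e]
  ring

theorem mul_integral (hp : p.Prime) (hx : PadicDvd p s x) (hy : PadicDvd p 0 y) :
    PadicDvd p s (x * y) :=
  hx.mul hp hy

theorem zero (hp : p.Prime) : PadicDvd p s 0 :=
  ⟨0, 1, (Nat.prime_iff_prime_int.mp hp).not_dvd_one, by simp⟩

theorem intCast (hp : p.Prime) (a : ℤ) : PadicDvd p 0 a :=
  ⟨a, 1, (Nat.prime_iff_prime_int.mp hp).not_dvd_one, by simp⟩

theorem natCast (hp : p.Prime) (a : ℕ) : PadicDvd p 0 a := mod_cast intCast hp a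

theorem prime_pow (hp : p.Prime) : PadicDvd p s ((p : ℚ) ^ s) :=
  ⟨1, 1, (Nat.prime_iff_prime_int.mp hp).not_dvd_one, by simp⟩

theorem inv_intCast {b : ℤ} (hb : ¬ (p : ℤ) ∣ b) : PadicDvd p 0 ((b : ℚ)⁻¹) := by
  have : (b : ℚ) ≠ 0 := by
    rintro h
    exact hb (by simp [Int.cast_eq_zero.mp h])
  exact ⟨1, b, hb, by simp [this]⟩

theorem natCast_of_dvd (hp : p.Prime) {a : ℕ} (h : p ∣ a) : PadicDvd p 1 a := by
  obtain ⟨k, rfl⟩ := h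
  exact ⟨k, 1, (Nat.prime_iff_prime_int.mp hp).not_dvd_one, by push_cast; ring⟩

theorem pow_dvd_num (hp : p.Prime) (hx : PadicDvd p s x) : (p : ℤ) ^ s ∣ x.num := by
  obtain ⟨a, b, hb, h⟩ := hx
  have hd : (x.den : ℚ) ≠ 0 := by exact_mod_cast x.den_nz
  have hxe : x * x.den = x.num := Rat.mul_den_eq_num x
  have key : x.num * b = (p : ℤ) ^ s * (a * x.den) := by
    have : (x.num : ℚ) * b = (p : ℚ) ^ s * (a * x.den) := by
      rw [← hxe]
      linear_combination (x.den : ℚ) * h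
    exact_mod_cast this
  have hc : IsCoprime ((p : ℤ) ^ s) b :=
    IsCoprime.pow_left ((Nat.prime_iff_prime_int.mp hp).coprime_iff_not_dvd.mpr hb)
  exact hc.dvd_of_dvd_mul_right ⟨_, key⟩

/-- A proper quotient `p ^ r / j` is divisible by `p`. -/
theorem prime_pow_div (hp : p.Prime) {r j : ℕ} (hj : 0 < j) (hjr : j < p ^ r) :
    PadicDvd p 1 ((p : ℚ) ^ r / j) := by
  obtain ⟨e, b, hb, rfl⟩ := Nat.exists_eq_pow_mul_and_not_dvd hj.ne' p hp.ne_one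
  have hb0 : 0 < b := Nat.pos_of_ne_zero (by rintro rfl; simp at hj)
  have he : e < r := by
    rw [← Nat.pow_lt_pow_iff_right hp.one_lt]
    exact lt_of_le_of_lt (Nat.le_mul_of_pos_right _ hb0) hjr
  obtain ⟨k, rfl⟩ := Nat.exists_eq_add_of_lt he
  have hp0 : (p : ℚ) ≠ 0 := by exact_mod_cast hp.ne_zero
  have hb0' : (b : ℚ) ≠ 0 := by exact_mod_cast hb0.ne'
  refine ⟨p ^ k, b, by exact_mod_cast hb, ?_⟩
  push_cast
  field_simp
  ring

theorem prod_sub_prod (hp : p.Prime) {f g : ℕ → ℚ} {n : ℕ}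
    (hg : ∀ j < n, PadicDvd p 0 (g j)) (hfg : ∀ j < n, PadicDvd p s (f j - g j)) :
    PadicDvd p s (∏ j ∈ Finset.range n, f j - ∏ j ∈ Finset.range n, g j) ∧
      PadicDvd p 0 (∏ j ∈ Finset.range n, f j) := by
  induction n with
  | zero => simpa using ⟨zero hp, by simpa using natCast hp 1⟩
  | succ n ih =>
    obtain ⟨h₁, h₂⟩ := ih (fun j hj => hg j (by omega)) (fun j hj => hfg j (by omega))
    have hn := hfg n (by omega)
    have hgn := hg n (by omega)
    have hfn : PadicDvd p 0 (f n) := by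
      simpa using (hn.mono (Nat.zero_le _)).add hp hgn
    rw [Finset.prod_range_succ, Finset.prod_range_succ]
    refine ⟨?_, h₂.mul_integral hp hfn⟩
    have := (h₁.mul_integral hp hgn).add hp (hn.mul_integral hp h₂)
    convert this using 1
    ring

theorem prod_sub_one (hp : p.Prime) {f : ℕ → ℚ} {n : ℕ}
    (hf : ∀ j < n, PadicDvd p s (f j - 1)) :
    PadicDvd p s (∏ j ∈ Finset.range n, f j - 1) := by
  simpa using (prod_sub_prod hp (g := fun _ => 1)
    (fun _ _ => by simpa using natCast hp 1) hf).1

/-- A factor congruent to `1` modulo `p` can be cancelled modulo `p ^ 2`. -/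
theorem of_mul_left (hp : p.Prime) (hx : PadicDvd p 1 (x - 1)) (hy : PadicDvd p 0 y)
    (hxy : PadicDvd p 2 (x * y)) : PadicDvd p 2 y := by
  have h₁ : PadicDvd p 1 y := by
    convert (hxy.mono one_le_two).sub hp (hx.mul_integral hp hy) using 1
    ring
  convert hxy.sub hp (hx.mul hp h₁) using 1
  ring

end PadicDvd

section BinomialProducts

theorem choose_eq_prod_one_sub (M k : ℕ) (hk : k ≤ M) :
    (M.choose k : ℚ) =
      (-1) ^ k * ∏ j ∈ Finset.range k, (1 - (M + 1 : ℚ) / ((j + 1 : ℕ) : ℚ)) := by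
  induction k with
  | zero => simp
  | succ k ih =>
    have h := Nat.choose_succ_right_eq M k
    have h' : (M.choose (k + 1) : ℚ) * (k + 1) = M.choose k * (M - k) := by
      rw [← Nat.cast_sub (by omega)]
      exact_mod_cast h
    have hk0 : (k + 1 : ℚ) ≠ 0 := by positivity
    rw [Finset.prod_range_succ, pow_succ]
    rw [ih (by omega)] at h'
    rw [← mul_left_inj' hk0, h']
    push_cast
    field_simp
    ring

theorem add_choose_eq_prod_one_add (M k : ℕ) :
    ((M + k).choose k : ℚ) = ∏ j ∈ Finset.range k, (1 + (M : ℚ) / ((j + 1 : ℕ) : ℚ)) := by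
  induction k with
  | zero => simp
  | succ k ih =>
    have h : ((M + k : ℕ) + 1 : ℚ) * (M + k).choose k = (M + k + 1).choose (k + 1) * (k + 1) := by
      exact_mod_cast Nat.add_one_mul_choose_eq (M + k) k
    have hk0 : (k + 1 : ℚ) ≠ 0 := by positivity
    rw [Finset.prod_range_succ, ← ih, ← mul_left_inj' hk0, ← add_assoc, ← h]
    push_cast
    field_simp
    ring

theorem centralBinom_eq_prod_one_sub (m : ℕ) :
    ((2 * m).choose m : ℚ) =
      (-4) ^ m * ∏ j ∈ Finset.range m, (1 - (2 * m + 1 : ℚ) / ((j + 1 : ℕ) : ℚ) / 2) := by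
  have h₁ : ∀ n : ℕ, ((2 * n).choose n : ℚ) =
      (∏ j ∈ Finset.range n, (2 * j + 1 : ℚ)) * ∏ j ∈ Finset.range n, (2 / (j + 1 : ℚ)) := by
    intro n
    induction n with
    | zero => simp
    | succ n ih =>
      have h := Nat.succ_mul_centralBinom_succ n
      simp only [Nat.centralBinom] at h
      have h' : ((n : ℚ) + 1) * (2 * (n + 1)).choose (n + 1) =
          2 * (2 * n + 1) * (2 * n).choose n := by exact_mod_cast h
      have hn0 : (n + 1 : ℚ) ≠ 0 := by positivity
      rw [Finset.prod_range_succ, Finset.prod_range_succ, ← mul_right_inj' hn0, h', ih]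
      field_simp
  rw [h₁, ← Finset.prod_range_reflect, ← Finset.prod_mul_distrib, ← Finset.card_range m,
    ← Finset.prod_const, Finset.card_range, ← Finset.prod_mul_distrib]
  refine Finset.prod_congr rfl fun j hj => ?_
  rw [Finset.mem_range] at hj
  rw [Nat.sub_sub, Nat.cast_sub (by omega)]
  push_cast
  field_simp
  ring

end BinomialProducts

section BinomialCongruences

variable {p r : ℕ}

theorem not_prime_dvd_two_pow (hp : p.Prime) (hp3 : 3 < p) (k : ℕ) : ¬ (p : ℤ) ∣ 2 ^ k := by
  intro h
  have h2 : p ∣ 2 := hp.dvd_of_dvd_pow (n := k) (by exact_mod_cast h)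
  exact absurd (Nat.le_of_dvd two_pos h2) (by omega)

theorem padicDvd_inv_two_pow (hp : p.Prime) (hp3 : 3 < p) (k : ℕ) :
    PadicDvd p 0 (((2 : ℚ) ^ k)⁻¹) := by
  simpa using PadicDvd.inv_intCast (not_prime_dvd_two_pow hp hp3 k)

/-- A prime power form of Babbage's congruence. -/
theorem padicDvd_choose_sub_one (hp : p.Prime) (hp3 : 3 < p) :
    PadicDvd p 2 (((p ^ r + (p ^ r - 1)).choose (p ^ r - 1) : ℚ) - 1) := by
  set N := p ^ r with hN
  set C : ℚ := ((N + (N - 1)).choose (N - 1) : ℚ) with hC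
  have hNr : (N : ℚ) = (p : ℚ) ^ r := by rw [hN]; push_cast; rfl
  have hprod := add_choose_eq_prod_one_add N (N - 1)
  have hdiv : ∀ j : ℕ, 0 < j → j < N → PadicDvd p 1 ((N : ℚ) / j) := by
    intro j h0 h1
    rw [hNr]
    exact PadicDvd.prime_pow_div hp h0 h1
  have hone : PadicDvd p 1 (C - 1) := by
    rw [hC, hprod]
    refine PadicDvd.prod_sub_one hp fun j hj => ?_
    simpa using hdiv (j + 1) (by omega) (by omega)
  have hsq : PadicDvd p 2 (C * C - 1) := by
    have hreflect : C * C = ∏ j ∈ Finset.range (N - 1),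
        ((1 + (N : ℚ) / ((N - 1 - 1 - j + 1 : ℕ) : ℚ)) * (1 + (N : ℚ) / ((j + 1 : ℕ) : ℚ))) := by
      rw [Finset.prod_mul_distrib, Finset.prod_range_reflect
        (fun j => 1 + (N : ℚ) / ((j + 1 : ℕ) : ℚ)), ← hprod]
    rw [hreflect]
    refine PadicDvd.prod_sub_one hp fun j hj => ?_
    have h := (hdiv (N - 1 - 1 - j + 1) (by omega) (by omega)).mul hp
      (hdiv (j + 1) (by omega) (by omega))
    have h2 := h.mul_integral hp (PadicDvd.natCast hp 2)
    convert h2 using 1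
    obtain ⟨i, hi⟩ : ∃ i, N = i + j + 2 := ⟨N - j - 2, by omega⟩
    have hi' : N - 1 - 1 - j + 1 = i + 1 := by omega
    rw [hi', hi]
    push_cast
    field_simp
    ring
  have htwo : PadicDvd p 0 ((2 : ℚ)⁻¹) := by simpa using padicDvd_inv_two_pow hp hp3 1
  refine PadicDvd.of_mul_left (x := (C + 1) * 2⁻¹) hp ?_ ?_ ?_
  · convert hone.mul_integral hp htwo using 1
    ring
  · exact hone.mono zero_le_one
  · convert hsq.mul_integral hp htwo using 1
    ring

/-- A prime power form of Morley's congruence modulo `p ^ 2`. -/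
theorem padicDvd_centralBinom_sub (hp : p.Prime) (hp3 : 3 < p) {m : ℕ} (hm : p ^ r = 2 * m + 1) :
    PadicDvd p 2 (((2 * m).choose m : ℚ) * (((2 : ℚ) ^ (4 * m))⁻¹) - (-1) ^ m) := by
  set y : ℕ → ℚ := fun j => (2 * m + 1 : ℚ) / ((j + 1 : ℕ) : ℚ) with hy
  set A : ℚ := ∏ j ∈ Finset.range m, (1 - y j) with hA
  set B : ℚ := ∏ j ∈ Finset.range m, (1 - y j / 2) with hB
  have hCA : ((2 * m).choose m : ℚ) = (-1) ^ m * A := by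
    have := choose_eq_prod_one_sub (2 * m) m (by omega)
    push_cast at this
    simpa [hA, hy] using this
  have hCB : ((2 * m).choose m : ℚ) = (-4) ^ m * B := centralBinom_eq_prod_one_sub m
  have hsign : ((-1 : ℚ) ^ m) * (-1) ^ m = 1 := by rw [← mul_pow]; norm_num
  have hAB : A = 4 ^ m * B := by
    have h4 : ((-4 : ℚ)) ^ m = (-1) ^ m * 4 ^ m := by rw [← mul_pow]; norm_num
    rw [hCA, h4] at hCB
    linear_combination ((-1 : ℚ) ^ m) * hCB - (A - 4 ^ m * B) * hsign
  have hNr : (2 * m + 1 : ℚ) = (p : ℚ) ^ r := by exact_mod_cast hm.symm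
  have hydvd : ∀ j < m, PadicDvd p 1 (y j) := by
    intro j hj
    simp only [hy]
    rw [hNr]
    exact PadicDvd.prime_pow_div hp (by omega) (by omega)
  have htwo : PadicDvd p 0 ((2 : ℚ)⁻¹) := by simpa using padicDvd_inv_two_pow hp hp3 1
  have hB1 : PadicDvd p 1 (B - 1) := by
    refine PadicDvd.prod_sub_one hp fun j hj => ?_
    convert ((hydvd j hj).mul_integral hp htwo).neg using 1
    ring
  have hsq : PadicDvd p 2 (B * B - A) := by
    rw [hB, ← Finset.prod_mul_distrib]
    refine (PadicDvd.prod_sub_prod hp (fun j hj => ?_) (fun j hj => ?_)).1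
    · have h1 : PadicDvd p 0 (1 : ℚ) := by simpa using PadicDvd.natCast hp 1
      exact h1.sub hp ((hydvd j hj).mono zero_le_one)
    · convert (((hydvd j hj).mul hp (hydvd j hj)).mul_integral hp htwo).mul_integral hp htwo
        using 1
      ring
  have hfour : PadicDvd p 0 ((4 : ℚ) ^ m) := by simpa using PadicDvd.natCast hp (4 ^ m)
  have hB4 : PadicDvd p 2 (B - 4 ^ m) := by
    refine PadicDvd.of_mul_left hp hB1 ?_ ?_
    · have h1 : PadicDvd p 0 (1 : ℚ) := by simpa using PadicDvd.natCast hp 1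
      convert ((hB1.mono zero_le_one).add hp h1).sub hp hfour using 1
      ring
    · convert hsq using 1
      rw [hAB]
      ring
  have hint : PadicDvd p 0 ((-4 : ℚ) ^ m) := by simpa using PadicDvd.intCast hp ((-4) ^ m)
  convert (hB4.mul_integral hp hint).mul_integral hp (padicDvd_inv_two_pow hp hp3 (4 * m)) using 1
  have h16 : (2 : ℚ) ^ (4 * m) = 4 ^ m * 4 ^ m := by rw [← mul_pow, pow_mul]; norm_num
  have h4 : ((-4 : ℚ)) ^ m = (-1) ^ m * 4 ^ m := by rw [← mul_pow]; norm_num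
  rw [hCB, h16, h4]
  field_simp

theorem prime_dvd_centralBinom (hp : p.Prime) (hr : 0 < r) {a : ℕ} (ha : a < p ^ r)
    (ha' : p ^ r ≤ 2 * a) : p ∣ (2 * a).choose a := by
  have : Fact p.Prime := ⟨hp⟩
  have hlog : Nat.log p (2 * a) < Nat.log p (2 * a) + 1 := Nat.lt_succ_self _
  have hval := padicValNat_choose (p := p) (show a ≤ 2 * a by omega) hlog
  apply dvd_of_one_le_padicValNat
  rw [hval, Nat.one_le_iff_ne_zero, Finset.card_ne_zero]
  refine ⟨r, ?_⟩
  have h2 : 2 * a - a = a := by omega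
  rw [Finset.mem_filter, Finset.mem_Ico, h2, Nat.mod_eq_of_lt ha]
  refine ⟨⟨hr, Nat.lt_succ_of_le (Nat.le_log_of_pow_le hp.one_lt ha')⟩, by omega⟩

end BinomialCongruences

section WilfZeilberger

open Nat

/-- The first component of the Wilf-Zeilberger pair, at the point `(2 * k + j, k)`. -/
def wzSummand (k j : ℕ) : ℚ :=
  (4 * k + 3 * j + 1) * 4 ^ k / (-8) ^ (2 * k + j) * (2 * (2 * k + j))! * (2 * (k + j))! ^ 2 /
    ((2 * k + j)! ^ 3 * (k + j)! ^ 2 * j !)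

/-- The second component of the Wilf-Zeilberger pair, at the point `(2 * k + 2 + i, k + 1)`. -/
def wzBoundary (k i : ℕ) : ℚ :=
  (2 * k + 2 + i) ^ 2 * 4 ^ (k + 1) / (-8) ^ (2 * k + 2 + i) * (2 * (2 * k + 2 + i))! *
    (2 * (k + 1 + i))! ^ 2 / ((2 * k + 2 + i)! ^ 3 * (k + 1 + i)! ^ 2 * (i + 1)!)

theorem wzSummand_sub (k i : ℕ) :
    wzSummand (k + 1) i - wzSummand k (i + 2) = wzBoundary k (i + 1) - wzBoundary k i := by
  unfold wzSummand wzBoundary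
  have e1 : 2 * (k + 1) + i = 2 * k + 2 + i := by ring
  have e2 : 2 * k + (i + 2) = 2 * k + 2 + i := by ring
  have e3 : 2 * k + 2 + (i + 1) = 2 * k + 2 + i + 1 := by ring
  have e4 : k + (i + 2) = k + 1 + i + 1 := by ring
  have e5 : k + 1 + (i + 1) = k + 1 + i + 1 := by ring
  have e6 : 2 * (2 * k + 2 + i + 1) = 2 * (2 * k + 2 + i) + 1 + 1 := by ring
  have e7 : 2 * (k + 1 + i + 1) = 2 * (k + 1 + i) + 1 + 1 := by ring
  rw [e1, e2, e3, e4, e5, e6, e7]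
  simp only [Nat.factorial_succ, pow_succ (4 : ℚ), pow_succ (-8 : ℚ) (2 * k + 2 + i)]
  have h1 : ((2 * k + 2 + i)! : ℚ) ≠ 0 := by positivity
  have h2 : ((k + 1 + i)! : ℚ) ≠ 0 := by positivity
  have h3 : ((i)! : ℚ) ≠ 0 := by positivity
  have h4 : ((-8 : ℚ)) ^ (2 * k + 2 + i) ≠ 0 := pow_ne_zero _ (by norm_num)
  generalize ((-8 : ℚ)) ^ (2 * k + 2 + i) = w at *
  push_cast
  generalize ((2 * k + 2 + i)! : ℚ) = u at *
  generalize ((k + 1 + i)! : ℚ) = v at *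
  generalize ((i)! : ℚ) = z at *
  field_simp
  ring

theorem wzSummand_zero_add_one (k : ℕ) :
    wzSummand k 0 + wzSummand k 1 = -wzBoundary k 0 := by
  unfold wzSummand wzBoundary
  have e2 : 2 * k + 2 + 0 = 2 * k + 1 + 1 := by ring
  have e5 : k + 1 + 0 = k + 1 := by ring
  have e6 : 2 * (2 * k + 1 + 1) = 2 * (2 * k) + 1 + 1 + 1 + 1 := by ring
  have e6' : 2 * (2 * k + 1) = 2 * (2 * k) + 1 + 1 := by ring
  have e7 : 2 * (k + 1) = 2 * k + 1 + 1 := by ring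
  rw [e2, e5, e6, e6', e7, Nat.add_zero, Nat.add_zero]
  simp only [Nat.factorial_succ, pow_succ (4 : ℚ), pow_succ (-8 : ℚ) (2 * k),
    pow_succ (-8 : ℚ) (2 * k + 1)]
  have h1 : ((2 * k)! : ℚ) ≠ 0 := by positivity
  have h2 : ((k)! : ℚ) ≠ 0 := by positivity
  have h4 : ((-8 : ℚ)) ^ (2 * k) ≠ 0 := pow_ne_zero _ (by norm_num)
  generalize ((-8 : ℚ)) ^ (2 * k) = w at *
  push_cast
  simp only [Nat.factorial_zero, Nat.cast_one]
  generalize ((2 * k)! : ℚ) = u at *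
  generalize ((k)! : ℚ) = v at *
  field_simp
  ring

theorem sum_wzSummand_sub (k i : ℕ) :
    ∑ j ∈ Finset.range i, wzSummand (k + 1) j - ∑ j ∈ Finset.range (i + 2), wzSummand k j =
      wzBoundary k i := by
  induction i with
  | zero =>
    simp only [Finset.sum_range_succ, Finset.sum_range_zero]
    linear_combination -wzSummand_zero_add_one k
  | succ i ih =>
    rw [Finset.sum_range_succ, Finset.sum_range_succ _ (i + 2)]
    linear_combination ih + wzSummand_sub k i

theorem wzSummand_zero_left (j : ℕ) :
    wzSummand 0 j = (3 * (j : ℚ) + 1) / (-8) ^ j * ((2 * j).choose j : ℚ) ^ 3 := by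
  have h1 : ((j)! : ℚ) ≠ 0 := by positivity
  rw [Nat.cast_choose ℚ (show j ≤ 2 * j by omega), show 2 * j - j = j by omega]
  simp only [wzSummand, Nat.mul_zero, Nat.zero_add, Nat.cast_zero, pow_zero]
  field_simp
  ring

theorem wzSummand_zero_right (m : ℕ) :
    wzSummand m 0 = (2 * m + 1 : ℕ) * ((2 * m + 1 + 2 * m).choose (2 * m) : ℚ) *
      (((2 * m).choose m : ℚ) * (((2 : ℚ) ^ (4 * m))⁻¹)) := by
  rw [Nat.cast_choose ℚ (show m ≤ 2 * m by omega),
    Nat.cast_choose ℚ (show 2 * m ≤ 2 * m + 1 + 2 * m by omega),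
    show 2 * m - m = m by omega, show 2 * m + 1 + 2 * m - 2 * m = 2 * m + 1 by omega,
    show 2 * m + 1 + 2 * m = 2 * (2 * m) + 1 by ring]
  simp only [wzSummand, Nat.add_zero, Nat.factorial_succ, Nat.factorial_zero]
  have h1 : ((m)! : ℚ) ≠ 0 := by positivity
  have h2 : ((2 * m)! : ℚ) ≠ 0 := by positivity
  have h8 : ((-8 : ℚ)) ^ (2 * m) = 4 ^ m * 2 ^ (4 * m) := by
    rw [pow_mul, pow_mul, ← mul_pow]
    norm_num
  rw [h8]
  push_cast
  field_simp
  ring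

theorem wzBoundary_eq (k i : ℕ) :
    wzBoundary k i = ((2 * k + 2 + i : ℕ) : ℚ) * (((2 * k + 2 + i : ℕ) : ℚ) / ((i + 1 : ℕ) : ℚ)) *
      ((2 * (k + 1 + i)).choose (k + 1 + i) : ℚ) *
      (((2 * (2 * k + 2 + i)).choose (2 * k + 2 + i) : ℚ) *
        ((2 * (k + 1 + i)).choose (2 * k + 2 + i) : ℚ) * 4 ^ (k + 1) *
        (-1) ^ (2 * k + 2 + i)) * (((2 : ℚ) ^ (3 * (2 * k + 2 + i)))⁻¹) := by
  rw [Nat.cast_choose ℚ (show k + 1 + i ≤ 2 * (k + 1 + i) by omega),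
    Nat.cast_choose ℚ (show 2 * k + 2 + i ≤ 2 * (2 * k + 2 + i) by omega),
    Nat.cast_choose ℚ (show 2 * k + 2 + i ≤ 2 * (k + 1 + i) by omega),
    show 2 * (k + 1 + i) - (k + 1 + i) = k + 1 + i by omega,
    show 2 * (2 * k + 2 + i) - (2 * k + 2 + i) = 2 * k + 2 + i by omega,
    show 2 * (k + 1 + i) - (2 * k + 2 + i) = i by omega]
  have h1 : ((2 * k + 2 + i)! : ℚ) ≠ 0 := by positivity
  have h2 : ((k + 1 + i)! : ℚ) ≠ 0 := by positivity
  have h3 : ((i)! : ℚ) ≠ 0 := by positivity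
  have h8 : ((-8 : ℚ)) ^ (2 * k + 2 + i) =
      (-1) ^ (2 * k + 2 + i) * 2 ^ (3 * (2 * k + 2 + i)) := by
    rw [pow_mul, ← mul_pow]
    norm_num
  have hs : ((-1 : ℚ) ^ (2 * k + 2 + i)) * (-1) ^ (2 * k + 2 + i) = 1 := by
    rw [← mul_pow]; norm_num
  have hinv : ((-1 : ℚ) ^ (2 * k + 2 + i))⁻¹ = (-1) ^ (2 * k + 2 + i) :=
    inv_eq_of_mul_eq_one_left hs
  simp only [wzBoundary, Nat.factorial_succ]
  rw [h8, div_eq_mul_inv (_ * _) ((-1 : ℚ) ^ _ * _), mul_inv, hinv]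
  push_cast
  field_simp

end WilfZeilberger

theorem padicDvd_wzBoundary {p r : ℕ} (hp : p.Prime) (hp3 : 3 < p) (hr : 0 < r) {k i : ℕ}
    (h : 2 * k + 2 + i = p ^ r) : PadicDvd p (r + 2) (wzBoundary k i) := by
  rw [wzBoundary_eq, h]
  have hN : ((p ^ r : ℕ) : ℚ) = (p : ℚ) ^ r := by push_cast; rfl
  have h₁ := (PadicDvd.prime_pow (s := r) hp).mul hp
    (PadicDvd.prime_pow_div (r := r) hp (Nat.succ_pos i) (by omega))
  have h₂ := h₁.mul hp (PadicDvd.natCast_of_dvd hp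
    (prime_dvd_centralBinom (a := k + 1 + i) hp hr (by omega) (by omega)))
  rw [hN]
  refine (h₂.mul_integral hp ?_).mul_integral hp (padicDvd_inv_two_pow hp hp3 _)
  exact_mod_cast PadicDvd.intCast hp _

theorem padicDvd_sum_wzSummand_sub {p r : ℕ} (hp : p.Prime) (hp3 : 3 < p) (hr : 0 < r) (k : ℕ)
    (hk : 2 * k ≤ p ^ r) :
    PadicDvd p (r + 2) (∑ j ∈ Finset.range (p ^ r), wzSummand 0 j -
      ∑ j ∈ Finset.range (p ^ r - 2 * k), wzSummand k j) := by
  induction k with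
  | zero => simpa using PadicDvd.zero hp
  | succ k ih =>
    have hstep := sum_wzSummand_sub k (p ^ r - 2 * (k + 1))
    rw [show p ^ r - 2 * (k + 1) + 2 = p ^ r - 2 * k by omega] at hstep
    convert (ih (by omega)).sub hp
      (padicDvd_wzBoundary hp hp3 hr (k := k) (i := p ^ r - 2 * (k + 1)) (by omega)) using 1
    linear_combination -hstep

/-- Theorem 1.2 (Mao): for any prime `p > 3` and integer `r > 0`,
`∑_{n=0}^{p^r-1} (3n+1)/(-8)^n C(2n,n)³ ≡ (-1)^{(p^r-1)/2} p^r (mod p^{r+2})`. -/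
theorem sum_three_n_add_one_prime_pow (p r : ℕ) (hp : p.Prime) (hp3 : 3 < p) (hr : 0 < r) :
    ((p : ℤ)) ^ (r + 2) ∣
      ((∑ n ∈ Finset.range (p ^ r),
          (3 * (n : ℚ) + 1) / (-8) ^ n * ((2 * n).choose n : ℚ) ^ 3) -
        (-1) ^ ((p ^ r - 1) / 2) * (p : ℚ) ^ r).num := by
  apply PadicDvd.pow_dvd_num hp
  obtain ⟨m, hm⟩ : Odd (p ^ r) := (hp.odd_of_ne_two (by omega)).pow
  have hsum := padicDvd_sum_wzSummand_sub hp hp3 hr m (by omega)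
  have hU := padicDvd_choose_sub_one (r := r) hp hp3
  have hV := padicDvd_centralBinom_sub hp hp3 hm
  have hN : (p : ℚ) ^ r = ((2 * m + 1 : ℕ) : ℚ) := by exact_mod_cast hm
  rw [show p ^ r - 2 * m = 1 by omega, Finset.sum_range_one, wzSummand_zero_right, ← hN] at hsum
  rw [show p ^ r - 1 = 2 * m by omega, hm] at hU
  rw [show (p ^ r - 1) / 2 = m by omega]
  simp only [wzSummand_zero_left] at hsum
  set U : ℚ := ((2 * m + 1 + 2 * m).choose (2 * m) : ℚ)
  set V : ℚ := ((2 * m).choose m : ℚ) * (((2 : ℚ) ^ (4 * m))⁻¹)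
  have hUint : PadicDvd p 0 U := PadicDvd.natCast hp _
  have hsign : PadicDvd p 0 ((-1 : ℚ) ^ m) := by
    simpa using PadicDvd.intCast hp ((-1) ^ m)
  have hUV := (hV.mul_integral hp hUint).add hp (hU.mul_integral hp hsign)
  convert hsum.add hp ((PadicDvd.prime_pow (s := r) hp).mul hp hUV) using 1
  ring
end

section
/- Let p > 3 be a prime. Then sum_{n=0}^{(p-1)/2} (3n+1)/(-8)^n * C(2n,n)^3 ≡ 4*(2|p)*sum_{n=0}^{p-1} (6n+1)/(-512)^n * C(2n,n)^3 - 3p*(-1|p) (mod p^4), where the congruence is between rational numbers whose denominators are coprime to p. -/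
section Interpolation

open Finset

open Polynomial in
/-- Lagrange interpolation, evaluated at `0`, of a sum of products that is known in closed form at
each of the nodes `y r`. -/
theorem sum_prod_eq_sum_interpolation (M : ℕ) (c γ y z v : ℕ → ℚ)
    (hy : Set.InjOn y (range (M + 1))) (hy0 : ∀ j, y j ≠ 0) (hz0 : ∀ j, z j ≠ 0)
    (hz : ∀ r, ∀ j < r, z j ≠ y r)
    (hv : ∀ r, ∑ n ∈ range (r + 1),
      c n * ∏ j ∈ range n, γ j * ((1 - y r / y j) / (1 - y r / z j)) = v r) :
    ∑ n ∈ range (M + 1), c n * ∏ j ∈ range n, γ j =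
      ∑ r ∈ range (M + 1), v r * (∏ j ∈ range M, (1 - y r / z j)) *
        ∏ s ∈ (range (M + 1)).erase r, y s / (y s - y r) := by
  set P : ℚ[X] := ∑ n ∈ range (M + 1), C (c n) *
    ((∏ j ∈ range n, (C (γ j) * (1 - C (y j)⁻¹ * X))) *
      ∏ j ∈ Ico n M, (1 - C (z j)⁻¹ * X)) with hP
  have hlin (u : ℚ) : (1 - C u * X : ℚ[X]).degree ≤ 1 := by
    compute_degree
  have hdeg : P.degree < #(range (M + 1)) := by
    rw [card_range, hP]
    refine lt_of_le_of_lt (degree_sum_le _ _) ?_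
    rw [Finset.sup_lt_iff (by exact WithBot.bot_lt_coe _)]
    intro n hn
    have hn' : n ≤ M := by simpa [Nat.lt_succ_iff] using hn
    have h1 : (∏ j ∈ range n, (C (γ j) * (1 - C (y j)⁻¹ * X))).natDegree ≤ n := by
      refine (natDegree_prod_le _ _).trans ?_
      refine (sum_le_card_nsmul _ _ 1 fun j _ => ?_).trans (by simp)
      exact (natDegree_C_mul_le _ _).trans (natDegree_le_of_degree_le (hlin _))
    have h2 : (∏ j ∈ Ico n M, (1 - C (z j)⁻¹ * X)).natDegree ≤ M - n := by
      refine (natDegree_prod_le _ _).trans ?_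
      refine (sum_le_card_nsmul _ _ 1 fun j _ => ?_).trans (by simp)
      exact natDegree_le_of_degree_le (hlin _)
    refine lt_of_le_of_lt degree_le_natDegree ?_
    have h3 := (natDegree_C_mul_le (c n) ((∏ j ∈ range n, (C (γ j) * (1 - C (y j)⁻¹ * X))) *
      ∏ j ∈ Ico n M, (1 - C (z j)⁻¹ * X))).trans (natDegree_mul_le.trans (Nat.add_le_add h1 h2))
    exact_mod_cast (show _ < M + 1 by omega)
  have heval (x : ℚ) : P.eval x = ∑ n ∈ range (M + 1), c n *
      ((∏ j ∈ range n, γ j * (1 - x / y j)) * ∏ j ∈ Ico n M, (1 - x / z j)) := by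
    simp only [hP, eval_finsetSum, eval_mul, eval_C, eval_prod, eval_sub, eval_one, eval_X,
      div_eq_inv_mul]
  have hnode : ∀ r ∈ range (M + 1), P.eval (y r) = v r * ∏ j ∈ range M, (1 - y r / z j) := by
    intro r hr
    have hr' : r + 1 ≤ M + 1 := by simpa [Nat.succ_le_iff] using hr
    rw [heval, ← hv, sum_mul, ← sum_subset (range_mono hr')]
    · refine sum_congr rfl fun n hn => ?_
      have hn' : n ≤ r := by simpa [Nat.lt_succ_iff] using hn
      rw [← prod_range_mul_prod_Ico (fun j => 1 - y r / z j) (hn'.trans (by omega : r ≤ M)),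
        mul_assoc, ← mul_assoc (∏ j ∈ range n, _) (∏ j ∈ range n, _), ← prod_mul_distrib]
      congr 2
      refine prod_congr rfl fun j hj => ?_
      have h1 : 1 - y r / z j ≠ 0 := by
        have := hz r j (by rw [mem_range] at hj; omega)
        rw [sub_ne_zero, ne_comm, Ne, div_eq_one_iff_eq (hz0 j)]
        exact this.symm
      field_simp
    · intro n _ hn
      have hn' : r < n := by simpa using hn
      rw [prod_eq_zero (mem_range.2 hn') (by rw [div_self (hy0 r)]; ring)]
      ring
  have h0 := congrArg (eval 0) (Lagrange.eq_interpolate (v := y) hy hdeg)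
  rw [heval, Lagrange.interpolate_apply, eval_finsetSum] at h0
  simp only [zero_div, sub_zero, mul_one, prod_const_one] at h0
  rw [h0]
  refine sum_congr rfl fun r hr => ?_
  rw [eval_mul, eval_C, hnode r hr, Lagrange.basis, eval_prod]
  congr 1
  refine prod_congr rfl fun s hs => ?_
  have hsr : y s - y r ≠ 0 := by
    rw [sub_ne_zero]
    intro h
    exact (ne_of_mem_erase hs) (hy (mem_of_mem_erase hs) hr h)
  have hrs : y r - y s ≠ 0 := by
    rwa [← neg_sub, neg_ne_zero]
  simp only [Lagrange.basisDivisor, eval_mul, eval_C, eval_sub, eval_X]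
  field_simp
  ring

theorem prod_sub_one_eq_and_prod_add_one_eq (b : ℚ) (n : ℕ) (hb : ∀ k : ℕ, k ≤ n + 1 → (k : ℚ) - b ≠ 0)
    (hb' : ∀ k : ℕ, (k : ℚ) + b ≠ 0) :
    (∏ j ∈ range n, -(2 * (j : ℚ) + 1) * ((2 * j + 1) ^ 2 - (b - 1) ^ 2) /
        ((j + 1) * ((j + 1) ^ 2 - (b - 1) ^ 2)) =
      (∏ j ∈ range n, -(2 * (j : ℚ) + 1) * ((2 * j) ^ 2 - b ^ 2) /
        ((j + 1) * ((j + 1) ^ 2 - b ^ 2))) *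
        ((2 * n - b) * (1 - b) * (n + b) / (-(b ^ 2) * (n + 1 - b)))) ∧
    (∏ j ∈ range n, -(2 * (j : ℚ) + 1) * ((2 * j + 1) ^ 2 - (b + 1) ^ 2) /
        ((j + 1) * ((j + 1) ^ 2 - (b + 1) ^ 2)) =
      (∏ j ∈ range n, -(2 * (j : ℚ) + 1) * ((2 * j) ^ 2 - b ^ 2) /
        ((j + 1) * ((j + 1) ^ 2 - b ^ 2))) *
        ((2 * n + b) * (1 + b) * (n - b) / (-(b ^ 2) * (n + 1 + b)))) := by
  have hb0 : b ≠ 0 := by simpa using hb' 0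
  have hb1 : (1 : ℚ) + b ≠ 0 := by simpa using hb' 1
  induction n with
  | zero =>
    have h1 : (1 : ℚ) - b ≠ 0 := by simpa using hb 1 (by omega)
    simp only [range_zero, prod_empty, CharP.cast_eq_zero, mul_zero, zero_add, zero_sub]
    constructor <;> field_simp
  | succ n ih =>
    obtain ⟨ih1, ih2⟩ := ih fun k hk => hb k (by omega)
    have h0 : (n : ℚ) - b ≠ 0 := hb n (by omega)
    have h1 : (n : ℚ) + 1 - b ≠ 0 := by exact_mod_cast hb (n + 1) (by omega)
    have h2 : (n : ℚ) + 1 + 1 - b ≠ 0 := by exact_mod_cast hb (n + 2) (by omega)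
    have h0' : (n : ℚ) + b ≠ 0 := hb' n
    have h1' : (n : ℚ) + 1 + b ≠ 0 := by exact_mod_cast hb' (n + 1)
    have h2' : (n : ℚ) + 1 + 1 + b ≠ 0 := by exact_mod_cast hb' (n + 2)
    have hn : (n : ℚ) + 1 ≠ 0 := by positivity
    rw [prod_range_succ, prod_range_succ, prod_range_succ, ih1, ih2,
      show ((n : ℚ) + 1) ^ 2 - (b - 1) ^ 2 = (n + 1 + 1 - b) * (n + b) by ring,
      show ((n : ℚ) + 1) ^ 2 - (b + 1) ^ 2 = (n + 1 + 1 + b) * (n - b) by ring,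
      show ((n : ℚ) + 1) ^ 2 - b ^ 2 = (n + 1 - b) * (n + 1 + b) by ring]
    push_cast
    constructor <;> field_simp <;> ring

theorem sum_three_mul_add_one_telescope (b : ℚ) (n : ℕ) (hb : ∀ k : ℕ, k ≤ n → (k : ℚ) - b ≠ 0)
    (hb' : ∀ k : ℕ, (k : ℚ) + b ≠ 0) (hb1 : b - 1 ≠ 0) :
    ∑ k ∈ range n, (3 * (k : ℚ) + 1) *
      ((∏ j ∈ range k, -(2 * (j : ℚ) + 1) * ((2 * j + 1) ^ 2 - (b + 1) ^ 2) /
        ((j + 1) * ((j + 1) ^ 2 - (b + 1) ^ 2))) / (b + 1) +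
      (∏ j ∈ range k, -(2 * (j : ℚ) + 1) * ((2 * j + 1) ^ 2 - (b - 1) ^ 2) /
        ((j + 1) * ((j + 1) ^ 2 - (b - 1) ^ 2))) / (b - 1)) =
    -(2 * n / b) * ∏ j ∈ range n, -(2 * (j : ℚ) + 1) * ((2 * j) ^ 2 - b ^ 2) /
        ((j + 1) * ((j + 1) ^ 2 - b ^ 2)) := by
  have hb0 : b ≠ 0 := by simpa using hb' 0
  have hb2 : b + 1 ≠ 0 := by simpa [add_comm] using hb' 1
  induction n with
  | zero => simp
  | succ n ih =>
    obtain ⟨e1, e2⟩ := prod_sub_one_eq_and_prod_add_one_eq b n hb hb'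
    have h1 : (n : ℚ) + 1 - b ≠ 0 := by exact_mod_cast hb (n + 1) (by omega)
    have h1' : (n : ℚ) + 1 + b ≠ 0 := by exact_mod_cast hb' (n + 1)
    have hn : (n : ℚ) + 1 ≠ 0 := by positivity
    rw [sum_range_succ, ih fun k hk => hb k (by omega), e1, e2, prod_range_succ,
      show ((n : ℚ) + 1) ^ 2 - b ^ 2 = (n + 1 - b) * (n + 1 + b) by ring]
    push_cast
    field_simp
    ring

theorem sum_three_mul_add_one_eq (r : ℕ) :
    ∑ n ∈ range (r + 1), (3 * (n : ℚ) + 1) * ∏ j ∈ range n, (-(2 * (j : ℚ) + 1) ^ 3 / (j + 1) ^ 3) *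
      ((1 - (2 * (r : ℚ) + 1) ^ 2 / (2 * j + 1) ^ 2) / (1 - (2 * (r : ℚ) + 1) ^ 2 / (j + 1) ^ 2)) =
    (-1) ^ r * (2 * r + 1) := by
  have hfac (a : ℚ) (j : ℕ) : (-(2 * (j : ℚ) + 1) ^ 3 / (j + 1) ^ 3) *
      ((1 - a ^ 2 / (2 * j + 1) ^ 2) / (1 - a ^ 2 / (j + 1) ^ 2)) =
      -(2 * (j : ℚ) + 1) * ((2 * j + 1) ^ 2 - a ^ 2) / ((j + 1) * ((j + 1) ^ 2 - a ^ 2)) := by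
    have h1 : (2 * (j : ℚ) + 1) ≠ 0 := by positivity
    have h2 : ((j : ℚ) + 1) ≠ 0 := by positivity
    rw [one_sub_div (pow_ne_zero 2 h1), one_sub_div (pow_ne_zero 2 h2), div_div_div_eq]
    field_simp
  simp only [hfac]
  set T : ℕ → ℕ → ℚ := fun r n => ∏ j ∈ range n, -(2 * (j : ℚ) + 1) *
    ((2 * j + 1) ^ 2 - (2 * (r : ℚ) + 1) ^ 2) / ((j + 1) * ((j + 1) ^ 2 - (2 * (r : ℚ) + 1) ^ 2))
    with hT
  change ∑ n ∈ range (r + 1), (3 * (n : ℚ) + 1) * T r n = _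
  induction r with
  | zero => simp [hT]
  | succ r ih =>
    rcases Nat.eq_zero_or_pos r with rfl | hr
    · norm_num [sum_range_succ, prod_range_succ, hT]
    have hr' : (1 : ℚ) ≤ r := by exact_mod_cast hr
    have key := sum_three_mul_add_one_telescope (2 * r + 2) (r + 2) (fun k hk => by
      have : (k : ℚ) ≤ r + 2 := by exact_mod_cast hk
      linarith) (fun k => by positivity) (by linarith)
    rw [prod_eq_zero (mem_range.2 (by omega : r + 1 < r + 2)) (by push_cast; ring), mul_zero,
      show (2 * (r : ℚ) + 2 - 1) = 2 * r + 1 by ring,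
      show (2 * (r : ℚ) + 2 + 1) = 2 * (r + 1 : ℕ) + 1 by push_cast; ring] at key
    change ∑ k ∈ range (r + 2), (3 * (k : ℚ) + 1) *
      (T (r + 1) k / (2 * (r + 1 : ℕ) + 1) + T r k / (2 * r + 1)) = 0 at key
    have h0 : T r (r + 1) = 0 := prod_eq_zero (mem_range.2 (by omega : r < r + 1)) (by simp)
    simp only [mul_add, mul_div_assoc', sum_add_distrib, ← sum_div] at key
    rw [sum_range_succ (fun k : ℕ => (3 * (k : ℚ) + 1) * T r k), h0, ih] at key
    have h1 : 2 * ((r + 1 : ℕ) : ℚ) + 1 ≠ 0 := by positivity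
    have h2 : 2 * (r : ℚ) + 1 ≠ 0 := by positivity
    field_simp at key
    refine mul_right_cancel₀ h2 ?_
    linear_combination key

theorem prod_sub_two_eq_and_prod_add_two_eq (b : ℚ) (n : ℕ) (hb1 : b + 1 ≠ 0) (hb1' : b - 1 ≠ 0)
    (hb : ∀ k : ℕ, 4 * (k : ℚ) + 2 - b ≠ 0) (hb' : ∀ k : ℕ, 4 * (k : ℚ) + 2 + b ≠ 0) :
    (∏ j ∈ range n, -(2 * (j : ℚ) + 1) * ((2 * j + 1) ^ 2 - (b - 2) ^ 2) /
        (4 * (j + 1) * (16 * (j + 1) ^ 2 - (b - 2) ^ 2)) =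
      (∏ j ∈ range n, -(2 * (j : ℚ) + 1) * ((2 * j - 1) ^ 2 - b ^ 2) /
        (4 * (j + 1) * ((4 * j + 2) ^ 2 - b ^ 2))) *
        ((2 * n - 1 - b) * (2 * n + 1 - b) * (2 - b) /
          ((b + 1) * (b - 1) * (4 * n + 2 - b)))) ∧
    (∏ j ∈ range n, -(2 * (j : ℚ) + 1) * ((2 * j + 1) ^ 2 - (b + 2) ^ 2) /
        (4 * (j + 1) * (16 * (j + 1) ^ 2 - (b + 2) ^ 2)) =
      (∏ j ∈ range n, -(2 * (j : ℚ) + 1) * ((2 * j - 1) ^ 2 - b ^ 2) /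
        (4 * (j + 1) * ((4 * j + 2) ^ 2 - b ^ 2))) *
        ((2 * n - 1 + b) * (2 * n + 1 + b) * (2 + b) /
          ((b - 1) * (b + 1) * (4 * n + 2 + b)))) := by
  induction n with
  | zero =>
    have h1 : 2 - b ≠ 0 := by simpa using hb 0
    have h2 : 2 + b ≠ 0 := by simpa using hb' 0
    simp only [range_zero, prod_empty, CharP.cast_eq_zero, mul_zero, zero_add, zero_sub]
    constructor <;> field_simp <;> ring
  | succ n ih =>
    obtain ⟨ih1, ih2⟩ := ih
    have h0 := hb n
    have h0' := hb' n
    have h1 : 4 * ((n : ℚ) + 1) + 2 - b ≠ 0 := by exact_mod_cast hb (n + 1)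
    have h1' : 4 * ((n : ℚ) + 1) + 2 + b ≠ 0 := by exact_mod_cast hb' (n + 1)
    have hn : (n : ℚ) + 1 ≠ 0 := by positivity
    rw [prod_range_succ, prod_range_succ, prod_range_succ, ih1, ih2,
      show 16 * ((n : ℚ) + 1) ^ 2 - (b - 2) ^ 2 =
        (4 * (n + 1) + 2 - b) * (4 * n + 2 + b) by ring,
      show 16 * ((n : ℚ) + 1) ^ 2 - (b + 2) ^ 2 =
        (4 * (n + 1) + 2 + b) * (4 * n + 2 - b) by ring,
      show (4 * (n : ℚ) + 2) ^ 2 - b ^ 2 = (4 * n + 2 - b) * (4 * n + 2 + b) by ring]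
    generalize ∏ j ∈ range n, -(2 * (j : ℚ) + 1) * ((2 * j - 1) ^ 2 - b ^ 2) /
      (4 * (j + 1) * ((4 * j + 2) ^ 2 - b ^ 2)) = m
    push_cast
    clear ih1 ih2 hb hb'
    generalize hu : 4 * (n : ℚ) + 2 - b = u at *
    generalize hv : 4 * (n : ℚ) + 2 + b = v at *
    generalize hu' : 4 * ((n : ℚ) + 1) + 2 - b = u' at *
    generalize hv' : 4 * ((n : ℚ) + 1) + 2 + b = v' at *
    constructor <;> field_simp <;> subst hu hv hu' hv' <;> ring

theorem sum_six_mul_add_one_telescope (b : ℚ) (n : ℕ) (hb1 : b + 1 ≠ 0) (hb1' : b - 1 ≠ 0)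
    (hb : ∀ k : ℕ, 4 * (k : ℚ) + 2 - b ≠ 0) (hb' : ∀ k : ℕ, 4 * (k : ℚ) + 2 + b ≠ 0)
    (hb2 : b - 2 ≠ 0) :
    ∑ k ∈ range n, (6 * (k : ℚ) + 1) *
      ((∏ j ∈ range k, -(2 * (j : ℚ) + 1) * ((2 * j + 1) ^ 2 - (b + 2) ^ 2) /
        (4 * (j + 1) * (16 * (j + 1) ^ 2 - (b + 2) ^ 2))) / (b + 2) +
      (∏ j ∈ range k, -(2 * (j : ℚ) + 1) * ((2 * j + 1) ^ 2 - (b - 2) ^ 2) /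
        (4 * (j + 1) * (16 * (j + 1) ^ 2 - (b - 2) ^ 2))) / (b - 2)) =
    -(8 * b * n / ((b - 1) * (b + 1))) *
      ∏ j ∈ range n, -(2 * (j : ℚ) + 1) * ((2 * j - 1) ^ 2 - b ^ 2) /
        (4 * (j + 1) * ((4 * j + 2) ^ 2 - b ^ 2)) := by
  have h2 : b + 2 ≠ 0 := by simpa [add_comm] using hb' 0
  induction n with
  | zero => simp
  | succ n ih =>
    obtain ⟨e1, e2⟩ := prod_sub_two_eq_and_prod_add_two_eq b n hb1 hb1' hb hb'
    have h0 := hb n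
    have h0' := hb' n
    have hn : (n : ℚ) + 1 ≠ 0 := by positivity
    rw [sum_range_succ, ih, e1, e2, prod_range_succ,
      show (4 * (n : ℚ) + 2) ^ 2 - b ^ 2 = (4 * n + 2 - b) * (4 * n + 2 + b) by ring]
    push_cast
    generalize ∏ j ∈ range n, -(2 * (j : ℚ) + 1) * ((2 * j - 1) ^ 2 - b ^ 2) /
      (4 * (j + 1) * ((4 * j + 2) ^ 2 - b ^ 2)) = m
    clear e1 e2 hb hb' ih
    generalize hu : 4 * (n : ℚ) + 2 - b = u at *
    generalize hv : 4 * (n : ℚ) + 2 + b = v at *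
    rw [add_comm 2 b]
    field_simp
    subst hu hv
    ring

theorem sum_six_mul_add_one_eq (r : ℕ) :
    ∑ n ∈ range (r + 1), (6 * (n : ℚ) + 1) *
      ∏ j ∈ range n, (-(2 * (j : ℚ) + 1) ^ 3 / (64 * (j + 1) ^ 3)) *
      ((1 - (2 * (r : ℚ) + 1) ^ 2 / (2 * j + 1) ^ 2) /
        (1 - (2 * (r : ℚ) + 1) ^ 2 / (16 * (j + 1) ^ 2))) =
    ZMod.χ₈' (2 * r + 1 : ℕ) * (2 * r + 1) := by
  have hfac (a : ℚ) (j : ℕ) : (-(2 * (j : ℚ) + 1) ^ 3 / (64 * (j + 1) ^ 3)) *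
      ((1 - a ^ 2 / (2 * j + 1) ^ 2) / (1 - a ^ 2 / (16 * (j + 1) ^ 2))) =
      -(2 * (j : ℚ) + 1) * ((2 * j + 1) ^ 2 - a ^ 2) /
        (4 * (j + 1) * (16 * (j + 1) ^ 2 - a ^ 2)) := by
    have h1 : (2 * (j : ℚ) + 1) ≠ 0 := by positivity
    have h2 : ((j : ℚ) + 1) ≠ 0 := by positivity
    rw [one_sub_div (pow_ne_zero 2 h1), one_sub_div (by positivity), div_div_div_eq]
    field_simp
    ring
  simp only [hfac]
  set T : ℕ → ℕ → ℚ := fun r n => ∏ j ∈ range n, -(2 * (j : ℚ) + 1) *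
    ((2 * j + 1) ^ 2 - (2 * (r : ℚ) + 1) ^ 2) /
      (4 * (j + 1) * (16 * (j + 1) ^ 2 - (2 * (r : ℚ) + 1) ^ 2)) with hT
  change ∑ n ∈ range (r + 1), (6 * (n : ℚ) + 1) * T r n = _
  induction r using Nat.twoStepInduction with
  | zero => simp [hT]
  | one =>
    have : ZMod.χ₈' ((3 : ℕ) : ZMod 8) = 1 := by decide
    norm_num [sum_range_succ, prod_range_succ, hT, this]
  | more r ih _ =>
    have hodd (k : ℕ) : 4 * (k : ℚ) + 2 - (2 * r + 3) ≠ 0 := by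
      intro h
      have : (4 * (k : ℤ) + 2 - (2 * r + 3)) = 0 := by exact_mod_cast h
      omega
    have hodd' : 2 * (r : ℚ) + 3 - 2 ≠ 0 := by
      rw [show 2 * (r : ℚ) + 3 - 2 = 2 * r + 1 by ring]
      positivity
    have key := sum_six_mul_add_one_telescope (2 * r + 3) (r + 3) (by positivity)
      (by rw [show 2 * (r : ℚ) + 3 - 1 = 2 * r + 2 by ring]; positivity) hodd
      (fun k => by positivity) hodd'
    rw [prod_eq_zero (mem_range.2 (by omega : r + 2 < r + 3)) (by push_cast; ring), mul_zero,
      show (2 * (r : ℚ) + 3 - 2) = 2 * r + 1 by ring,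
      show (2 * (r : ℚ) + 3 + 2) = 2 * (r + 2 : ℕ) + 1 by push_cast; ring] at key
    change ∑ k ∈ range (r + 3), (6 * (k : ℚ) + 1) *
      (T (r + 2) k / (2 * (r + 2 : ℕ) + 1) + T r k / (2 * r + 1)) = 0 at key
    have h0 : T r (r + 1) = 0 := prod_eq_zero (mem_range.2 (by omega : r < r + 1)) (by simp)
    have h0' : T r (r + 2) = 0 := prod_eq_zero (mem_range.2 (by omega : r < r + 2)) (by simp)
    simp only [mul_add, mul_div_assoc', sum_add_distrib, ← sum_div] at key
    rw [sum_range_succ (fun k : ℕ => (6 * (k : ℚ) + 1) * T r k), h0',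
      sum_range_succ (fun k : ℕ => (6 * (k : ℚ) + 1) * T r k), h0, ih] at key
    have hχ : ZMod.χ₈' ((2 * (r + 2) + 1 : ℕ) : ZMod 8) = -ZMod.χ₈' ((2 * r + 1 : ℕ) : ZMod 8) := by
      push_cast
      rw [show 2 * ((r : ZMod 8) + 2) + 1 = 2 * r + 1 + 4 by ring]
      generalize 2 * (r : ZMod 8) + 1 = x
      revert x
      decide
    rw [hχ]
    have h1 : 2 * ((r + 2 : ℕ) : ℚ) + 1 ≠ 0 := by positivity
    have h2 : 2 * (r : ℚ) + 1 ≠ 0 := by positivity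
    field_simp at key
    refine mul_right_cancel₀ h2 ?_
    push_cast at key ⊢
    linear_combination key

/-- The rational number `x` has denominator prime to `p` and reduces to `y` modulo `p`. -/
def RatReduces (p : ℕ) [Fact p.Prime] (x : ℚ) (y : ZMod p) : Prop :=
  ∃ a b : ℤ, (b : ZMod p) ≠ 0 ∧ x = a / b ∧ y = a / b

namespace RatReduces

variable {p : ℕ} [Fact p.Prime] {x₁ x₂ x : ℚ} {y₁ y₂ y : ZMod p}

theorem intCast_ne_zero {b : ℤ} (hb : (b : ZMod p) ≠ 0) : (b : ℚ) ≠ 0 := by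
  rintro h
  rw [Int.cast_eq_zero] at h
  simp [h] at hb

theorem of_eq (h : RatReduces p x y₁) (hy : y₁ = y₂) : RatReduces p x y₂ := hy ▸ h

theorem intCast (a : ℤ) : RatReduces p a a := ⟨a, 1, by simp, by simp, by simp⟩

theorem natCast (a : ℕ) : RatReduces p a a := by simpa using intCast (p := p) a

theorem one : RatReduces p 1 1 := by simpa using natCast (p := p) 1

theorem two : RatReduces p 2 2 := by simpa using natCast (p := p) 2

theorem four : RatReduces p 4 4 := by simpa using natCast (p := p) 4

theorem zero : RatReduces p 0 0 := by simpa using natCast (p := p) 0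

theorem self : RatReduces p p 0 := by simpa using natCast (p := p) p

theorem add (h₁ : RatReduces p x₁ y₁) (h₂ : RatReduces p x₂ y₂) :
    RatReduces p (x₁ + x₂) (y₁ + y₂) := by
  obtain ⟨a, b, hb, rfl, rfl⟩ := h₁
  obtain ⟨c, d, hd, rfl, rfl⟩ := h₂
  have hb' := intCast_ne_zero hb
  have hd' := intCast_ne_zero hd
  refine ⟨a * d + b * c, b * d, ?_, ?_, ?_⟩
  · push_cast; exact mul_ne_zero hb hd
  · push_cast; exact div_add_div _ _ hb' hd'
  · push_cast; exact div_add_div _ _ hb hd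

theorem mul (h₁ : RatReduces p x₁ y₁) (h₂ : RatReduces p x₂ y₂) :
    RatReduces p (x₁ * x₂) (y₁ * y₂) := by
  obtain ⟨a, b, hb, rfl, rfl⟩ := h₁
  obtain ⟨c, d, hd, rfl, rfl⟩ := h₂
  refine ⟨a * c, b * d, ?_, ?_, ?_⟩
  · push_cast; exact mul_ne_zero hb hd
  · push_cast; exact div_mul_div_comm _ _ _ _
  · push_cast; exact div_mul_div_comm _ _ _ _

theorem neg (h : RatReduces p x y) : RatReduces p (-x) (-y) := by
  simpa using (intCast (p := p) (-1)).mul h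

theorem sub (h₁ : RatReduces p x₁ y₁) (h₂ : RatReduces p x₂ y₂) :
    RatReduces p (x₁ - x₂) (y₁ - y₂) := by
  simpa [sub_eq_add_neg] using h₁.add h₂.neg

theorem inv (h : RatReduces p x y) (hy : y ≠ 0) : RatReduces p x⁻¹ y⁻¹ := by
  obtain ⟨a, b, hb, rfl, rfl⟩ := h
  exact ⟨b, a, (div_ne_zero_iff.1 hy).1, inv_div _ _, inv_div _ _⟩

theorem div (h₁ : RatReduces p x₁ y₁) (h₂ : RatReduces p x₂ y₂) (hy : y₂ ≠ 0) :
    RatReduces p (x₁ / x₂) (y₁ / y₂) := by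
  simpa [div_eq_mul_inv] using h₁.mul (h₂.inv hy)

theorem pow (h : RatReduces p x y) (n : ℕ) : RatReduces p (x ^ n) (y ^ n) := by
  induction n with
  | zero => simpa using one
  | succ n ih => simpa [pow_succ] using ih.mul h

theorem prod {ι : Type*} {s : Finset ι} {f : ι → ℚ} {g : ι → ZMod p}
    (h : ∀ i ∈ s, RatReduces p (f i) (g i)) : RatReduces p (∏ i ∈ s, f i) (∏ i ∈ s, g i) := by
  classical
  induction s using Finset.induction_on with
  | empty => simpa using one
  | insert i s hi ih =>
    rw [prod_insert hi, prod_insert hi]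
    exact (h i (mem_insert_self _ _)).mul (ih fun j hj => h j (mem_insert_of_mem hj))

theorem sum {ι : Type*} {s : Finset ι} {f : ι → ℚ} {g : ι → ZMod p}
    (h : ∀ i ∈ s, RatReduces p (f i) (g i)) : RatReduces p (∑ i ∈ s, f i) (∑ i ∈ s, g i) := by
  classical
  induction s using Finset.induction_on with
  | empty => simpa using zero
  | insert i s hi ih =>
    rw [sum_insert hi, sum_insert hi]
    exact (h i (mem_insert_self _ _)).add (ih fun j hj => h j (mem_insert_of_mem hj))

theorem exists_sum_eq_mul {ι : Type*} {s : Finset ι} {f : ι → ℚ} {g : ι → ZMod p} (k : ℚ)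
    (h : ∀ i ∈ s, ∃ x, RatReduces p x (g i) ∧ f i = k * x) :
    ∃ x, RatReduces p x (∑ i ∈ s, g i) ∧ ∑ i ∈ s, f i = k * x := by
  choose! x hx hf using h
  exact ⟨∑ i ∈ s, x i, sum hx, by rw [mul_sum]; exact sum_congr rfl hf⟩

theorem ne_zero (h : RatReduces p x y) (hy : y ≠ 0) : x ≠ 0 := by
  obtain ⟨a, b, hb, rfl, rfl⟩ := h
  exact div_ne_zero (intCast_ne_zero (div_ne_zero_iff.1 hy).1) (intCast_ne_zero hb)

theorem pow_succ_dvd_num (h : RatReduces p x 0) (k : ℕ) :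
    (p : ℤ) ^ (k + 1) ∣ ((p : ℚ) ^ k * x).num := by
  obtain ⟨a, b, hb, rfl, hy⟩ := h
  have ha : (p : ℤ) ∣ a := by
    rw [← ZMod.intCast_zmod_eq_zero_iff_dvd]
    exact (div_eq_zero_iff.1 hy.symm).resolve_right hb
  have hb' : IsCoprime ((p : ℤ) ^ (k + 1)) b := by
    refine IsCoprime.pow_left ((Nat.prime_iff_prime_int.1 Fact.out).coprime_iff_not_dvd.2 ?_)
    rwa [← ZMod.intCast_zmod_eq_zero_iff_dvd]
  set q : ℚ := (p : ℚ) ^ k * (a / b) with hq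
  have hbq := intCast_ne_zero hb
  have h1 : q.num * b = (p : ℤ) ^ k * a * q.den := by
    have h2 : (q.num : ℚ) / q.den * b = (p : ℚ) ^ k * a := by
      rw [Rat.num_div_den, hq]
      field_simp
    have h3 : (q.den : ℚ) ≠ 0 := by exact_mod_cast q.den_ne_zero
    field_simp at h2
    have h4 : (q.num : ℚ) * b = (p : ℚ) ^ k * a * q.den := by rw [h2]; ring
    exact_mod_cast h4
  refine hb'.dvd_of_dvd_mul_right (h1 ▸ ?_)
  rw [pow_succ]
  exact Dvd.dvd.mul_right (mul_dvd_mul_left _ ha) _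

end RatReduces

/-- The rational number `x` has the form `1 + p ^ 2 * z` with `z` reducing to `y` modulo `p`. -/
def OneAddSqReduces (p : ℕ) [Fact p.Prime] (x : ℚ) (y : ZMod p) : Prop :=
  ∃ z : ℚ, RatReduces p z y ∧ x = 1 + p ^ 2 * z

namespace OneAddSqReduces

variable {p : ℕ} [Fact p.Prime] {x₁ x₂ x u : ℚ} {y₁ y₂ y : ZMod p}

theorem one_sub (h : RatReduces p u y) : OneAddSqReduces p (1 - p ^ 2 * u) (-y) :=
  ⟨-u, h.neg, by ring⟩

theorem mul (h₁ : OneAddSqReduces p x₁ y₁) (h₂ : OneAddSqReduces p x₂ y₂) :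
    OneAddSqReduces p (x₁ * x₂) (y₁ + y₂) := by
  obtain ⟨z₁, h₁, rfl⟩ := h₁
  obtain ⟨z₂, h₂, rfl⟩ := h₂
  refine ⟨z₁ + z₂ + p ^ 2 * (z₁ * z₂), ?_, by ring⟩
  simpa using (h₁.add h₂).add ((RatReduces.self.pow 2).mul (h₁.mul h₂))

theorem inv (h : OneAddSqReduces p x y) : OneAddSqReduces p x⁻¹ (-y) := by
  obtain ⟨z, h, rfl⟩ := h
  have h1 : RatReduces p (1 + p ^ 2 * z) 1 := by
    simpa using RatReduces.one.add ((RatReduces.self.pow 2).mul h)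
  have h2 := h1.ne_zero one_ne_zero
  refine ⟨-(z / (1 + p ^ 2 * z)), by simpa using (h.div h1 one_ne_zero).neg, ?_⟩
  field_simp
  ring

theorem prod {ι : Type*} {s : Finset ι} {f : ι → ℚ} {g : ι → ZMod p}
    (h : ∀ i ∈ s, OneAddSqReduces p (f i) (g i)) :
    OneAddSqReduces p (∏ i ∈ s, f i) (∑ i ∈ s, g i) := by
  classical
  induction s using Finset.induction_on with
  | empty => exact ⟨0, by simpa using RatReduces.zero, by simp⟩
  | insert i s hi ih =>
    rw [prod_insert hi, sum_insert hi]
    exact (h i (mem_insert_self _ _)).mul (ih fun j hj => h j (mem_insert_of_mem hj))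

end OneAddSqReduces

section ResidueSystem

variable {p : ℕ} [Fact p.Prime] {ι : Type*} {S : Finset ι} {c : ι → ZMod p}

theorem image_eq_univ_erase_zero (hinj : Set.InjOn c S) (h0 : ∀ s ∈ S, c s ≠ 0)
    (hcard : #S = p - 1) : S.image c = univ.erase 0 := by
  refine eq_of_subset_of_card_le ?_ ?_
  · intro y hy
    obtain ⟨s, hs, rfl⟩ := mem_image.1 hy
    simpa using h0 s hs
  · rw [card_erase_of_mem (mem_univ _), card_univ, ZMod.card, card_image_of_injOn hinj, hcard]

@[to_additive]
theorem prod_eq_prod_univ_erase_zero {M : Type*} [CommMonoid M] (hinj : Set.InjOn c S)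
    (h0 : ∀ s ∈ S, c s ≠ 0) (hcard : #S = p - 1) (g : ZMod p → M) :
    ∏ s ∈ S, g (c s) = ∏ y ∈ univ.erase 0, g y := by
  rw [← image_eq_univ_erase_zero hinj h0 hcard, prod_image hinj]

@[to_additive]
theorem prod_half_eq_prod_univ_erase_zero {M : Type*} [CommMonoid M] (hinj : Set.InjOn c S)
    (hneg : ∀ s ∈ S, ∀ t ∈ S, c s ≠ -c t) (hcard : 2 * #S = p - 1) (g : ZMod p → M) :
    ∏ s ∈ S, (g (c s) * g (-c s)) = ∏ y ∈ univ.erase 0, g y := by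
  have h0 : ∀ s ∈ S, c s ≠ 0 := fun s hs h => hneg s hs s hs (by rw [h, neg_zero])
  have key := prod_eq_prod_univ_erase_zero (S := S.disjSum S)
    (c := Sum.elim c fun s => -c s) ?_ ?_ ?_ g
  · rw [← key, prod_disjSum, prod_mul_distrib]
    simp
  · rintro (s | s) hs (t | t) ht h
    · simp only [Sum.elim_inl, mem_coe, inl_mem_disjSum] at *
      rw [hinj hs ht h]
    · simp only [Sum.elim_inl, Sum.elim_inr, mem_coe, inl_mem_disjSum, inr_mem_disjSum] at *
      exact absurd h (hneg s hs t ht)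
    · simp only [Sum.elim_inl, Sum.elim_inr, mem_coe, inl_mem_disjSum, inr_mem_disjSum] at *
      exact absurd h.symm (hneg t ht s hs)
    · simp only [Sum.elim_inr, mem_coe, inr_mem_disjSum, neg_inj] at *
      rw [hinj hs ht h]
  · rintro (s | s) hs
    · simpa using h0 s (by simpa using hs)
    · simpa using h0 s (by simpa using hs)
  · rw [card_disjSum]
    omega

theorem prod_univ_erase_zero_eq_neg_one : ∏ y ∈ (univ : Finset (ZMod p)).erase 0, y = -1 := by
  have h := ZMod.prod_Ico_one_prime p
  rw [← h]
  refine (prod_eq_prod_univ_erase_zero (S := Ico 1 p) (c := fun k => (k : ZMod p)) ?_ ?_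
    (by simp) id).symm
  · intro s hs t ht hst
    simp only [coe_Ico, Set.mem_Ico] at hs ht
    have := (ZMod.natCast_eq_natCast_iff' _ _ _).1 hst
    rwa [Nat.mod_eq_of_lt hs.2, Nat.mod_eq_of_lt ht.2] at this
  · intro s hs h
    rw [ZMod.natCast_eq_zero_iff] at h
    rw [mem_Ico] at hs
    exact absurd (Nat.le_of_dvd (by omega) h) (by omega)

/-- `1 + x / y`, with the factors at `y = ± x` replaced by `1`. -/
theorem prod_one_add_div_eq_neg_half (hp : 2 < p) {x : ZMod p} (hx : x ≠ 0) :
    ∏ y ∈ univ.erase 0, (if y = x ∨ y = -x then 1 else 1 + x / y) = -1 / 2 := by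
  have : Fact (2 < p) := ⟨hp⟩
  have h2 : (2 : ZMod p) ≠ 0 := by
    have := ZMod.neg_one_ne_one (n := p)
    intro h
    exact this (by linear_combination -h)
  have hne : x ≠ -x := by
    intro h
    exact mul_ne_zero h2 hx (by linear_combination h)
  have h1 : ∏ y ∈ (univ.erase 0).erase (-x), (1 + x / y) = -1 := by
    rw [← prod_univ_erase_zero_eq_neg_one, ← mul_prod_erase (univ.erase 0) _ (by simp :
      (1 : ZMod p) ∈ univ.erase 0), one_mul]
    refine prod_nbij' (fun y => 1 + x / y) (fun w => x / (w - 1)) ?_ ?_ ?_ ?_ ?_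
    · intro y hy
      simp only [mem_erase, mem_univ, and_true] at hy ⊢
      refine ⟨?_, ?_⟩
      · simpa using ⟨hx, hy.2⟩
      · intro h
        have h0 := hy.2
        field_simp at h
        exact hy.1 (by linear_combination h)
    · intro w hw
      simp only [mem_erase, mem_univ, and_true] at hw ⊢
      have hw' : w - 1 ≠ 0 := sub_ne_zero.2 hw.1
      refine ⟨?_, div_ne_zero hx hw'⟩
      intro h
      field_simp at h
      apply hw.2
      linear_combination h
    · intro y hy
      simp only [mem_erase, mem_univ, and_true] at hy
      have := hy.2
      field_simp
      simp [hx]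
    · intro w hw
      simp only [mem_erase, mem_univ, and_true] at hw
      have hw' : w - 1 ≠ 0 := sub_ne_zero.2 hw.1
      field_simp
      ring
    · intro y _
      rfl
  have hm : x ∈ (univ.erase (0 : ZMod p)).erase (-x) := by simp [hne, hx]
  have hm' : -x ∈ univ.erase (0 : ZMod p) := by simp [hx]
  rw [← mul_prod_erase _ _ hm, div_self hx, one_add_one_eq_two] at h1
  rw [eq_div_iff h2, ← h1, ← mul_prod_erase _ _ hm', ← mul_prod_erase _ _ hm, mul_comm]
  simp only [true_or, or_true, if_true, one_mul]
  congr 1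
  refine prod_congr rfl fun y hy => ?_
  simp only [mem_erase] at hy
  rw [if_neg (by tauto)]

theorem prod_half_erase_one_sub_sq [DecidableEq ι] (hp : 2 < p) (hinj : Set.InjOn c S)
    (hneg : ∀ s ∈ S, ∀ t ∈ S, c s ≠ -c t) (hcard : 2 * #S = p - 1) {x : ZMod p} {s₀ : ι}
    (hs₀ : s₀ ∈ S) (hx : c s₀ = x ∨ c s₀ = -x) :
    ∏ s ∈ S.erase s₀, (1 - x ^ 2 / c s ^ 2) = -1 / 2 := by
  have h0 : ∀ s ∈ S, c s ≠ 0 := fun s hs h => hneg s hs s hs (by rw [h, neg_zero])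
  have hx0 : x ≠ 0 := by
    rintro rfl
    exact h0 s₀ hs₀ (by simpa using hx)
  rw [← prod_one_add_div_eq_neg_half hp hx0,
    ← prod_half_eq_prod_univ_erase_zero hinj hneg hcard, ← mul_prod_erase _ _ hs₀]
  rw [if_pos hx, if_pos (by rcases hx with h | h <;> simp [h]), one_mul, one_mul]
  refine prod_congr rfl fun s hs => ?_
  obtain ⟨hs1, hs2⟩ := mem_erase.1 hs
  have h1 : ¬ (c s = x ∨ c s = -x) := by
    rintro (h | h) <;> rcases hx with h' | h'
    · exact hs1 (hinj hs2 hs₀ (h.trans h'.symm))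
    · exact hneg s hs2 s₀ hs₀ (by rw [h, h', neg_neg])
    · exact hneg s hs2 s₀ hs₀ (by rw [h, h'])
    · exact hs1 (hinj hs2 hs₀ (h.trans h'.symm))
  rw [if_neg h1, if_neg (by rw [neg_eq_iff_eq_neg, neg_inj]; tauto)]
  have := h0 s hs2
  field_simp
  ring

theorem prod_erase_erase_one_sub_sq [DecidableEq ι] (hp : 2 < p) (hinj : Set.InjOn c S)
    (h0 : ∀ s ∈ S, c s ≠ 0) (hcard : #S = p - 1) {x : ZMod p} {s₁ s₂ : ι} (h12 : s₁ ≠ s₂)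
    (hs₁ : s₁ ∈ S) (hs₂ : s₂ ∈ S) (h₁ : c s₁ = x) (h₂ : c s₂ = -x) :
    ∏ s ∈ (S.erase s₁).erase s₂, (1 - x ^ 2 / c s ^ 2) = 1 / 4 := by
  have hx0 : x ≠ 0 := h₁ ▸ h0 s₁ hs₁
  have hs₂' : s₂ ∈ S.erase s₁ := mem_erase.2 ⟨h12.symm, hs₂⟩
  have e1 := prod_one_add_div_eq_neg_half hp hx0
  have e2 := prod_one_add_div_eq_neg_half hp (neg_ne_zero.2 hx0)
  rw [← prod_eq_prod_univ_erase_zero hinj h0 hcard, ← mul_prod_erase _ _ hs₁,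
    ← mul_prod_erase _ _ hs₂', if_pos (by simp [h₁]), if_pos (by simp [h₂]), one_mul,
    one_mul] at e1 e2
  calc _ = (-1 / 2 : ZMod p) * (-1 / 2) := by
        nth_rewrite 1 [← e1]
        rw [← e2, ← prod_mul_distrib]
        refine prod_congr rfl fun s hs => ?_
        obtain ⟨hs2, hs1, hs⟩ := by simpa only [mem_erase] using hs
        have hn1 : c s ≠ x := fun h => hs1 (hinj hs hs₁ (h.trans h₁.symm))
        have hn2 : c s ≠ -x := fun h => hs2 (hinj hs hs₂ (h.trans h₂.symm))
        rw [if_neg (by tauto), if_neg (by rw [neg_neg]; tauto)]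
        have := h0 s hs
        field_simp
        ring
    _ = 1 / 4 := by rw [div_mul_div_comm]; norm_num

theorem sum_univ_erase_zero_inv_sq (hp : 3 < p) : 
    ∑ y ∈ (univ : Finset (ZMod p)).erase 0, 1 / y ^ 2 = 0 := by
  have h := FiniteField.sum_pow_lt_card_sub_one (ZMod p) 2 (by rw [ZMod.card]; omega)
  rw [← add_sum_erase _ _ (mem_univ 0), zero_pow two_ne_zero, zero_add] at h
  refine Eq.trans ?_ h
  refine sum_nbij' (·⁻¹) (·⁻¹) ?_ ?_ ?_ ?_ ?_ <;> simp

theorem sum_half_inv_sq (hp : 3 < p) (hinj : Set.InjOn c S)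
    (hneg : ∀ s ∈ S, ∀ t ∈ S, c s ≠ -c t) (hcard : 2 * #S = p - 1) :
    ∑ s ∈ S, 1 / c s ^ 2 = 0 := by
  have : Fact (2 < p) := ⟨by omega⟩
  have h := sum_half_eq_sum_univ_erase_zero hinj hneg hcard fun y => 1 / y ^ 2
  rw [sum_univ_erase_zero_inv_sq hp] at h
  simp only [neg_sq, ← two_mul, ← mul_sum] at h
  refine (mul_eq_zero.1 h).resolve_left fun h2 => ?_
  exact ZMod.neg_one_ne_one (n := p) (by linear_combination -h2)

end ResidueSystem

section SumsOverNodes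

theorem natCast_eq_two_mul_add_one {p m : ℕ} (hpm : p = 2 * m + 1) : (p : ℚ) = 2 * m + 1 := by
  rw [hpm]
  push_cast
  rfl

variable {p m : ℕ} [Fact p.Prime]

theorem intCast_zmod_eq_zero_of_abs_lt {a : ℤ} (ha : (a : ZMod p) = 0) (h : |a| < 2 * p) :
    a = 0 ∨ a = p ∨ a = -p := by
  obtain ⟨k, rfl⟩ := (ZMod.intCast_zmod_eq_zero_iff_dvd a p).1 ha
  have hp : (0 : ℤ) < p := by exact_mod_cast (Fact.out : p.Prime).pos
  rw [abs_mul, abs_of_pos hp, mul_comm 2] at h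
  have hk := abs_lt.1 (lt_of_mul_lt_mul_left h hp.le)
  obtain rfl | rfl | rfl : k = 0 ∨ k = 1 ∨ k = -1 := by omega
  all_goals simp

theorem zmod_eq_iff_of_lt {a b : ℤ} (h : |a - b| < 2 * p) :
    (a : ZMod p) = b ↔ a = b ∨ a = b + p ∨ a = b - p := by
  constructor
  · intro hab
    have := intCast_zmod_eq_zero_of_abs_lt (p := p) (a := a - b)
      (by push_cast; exact sub_eq_zero.2 hab) h
    omega
  · rintro (rfl | rfl | rfl) <;> simp

theorem injOn_natCast_add_one_half (hpm : p = 2 * m + 1) :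
    Set.InjOn (fun j : ℕ => (j : ZMod p) + 1) (range m) := by
  intro j hj k hk h
  simp only [coe_range, Set.mem_Iio] at hj hk
  have := (zmod_eq_iff_of_lt (p := p) (a := j + 1) (b := k + 1)
    (by rw [abs_lt]; omega)).1 (by push_cast; exact h)
  omega

theorem natCast_add_one_ne_neg_half (hpm : p = 2 * m + 1) :
    ∀ j ∈ range m, ∀ k ∈ range m, (j : ZMod p) + 1 ≠ -((k : ZMod p) + 1) := by
  intro j hj k hk h
  simp only [mem_range] at hj hk
  have := (zmod_eq_iff_of_lt (p := p) (a := j + 1) (b := -(k + 1))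
    (by rw [abs_lt]; omega)).1 (by push_cast; exact h)
  omega

theorem injOn_two_mul_add_one (hpm : p = 2 * m + 1) :
    Set.InjOn (fun j : ℕ => 2 * (j : ZMod p) + 1) (range (2 * m + 1)) := by
  intro j hj k hk h
  simp only [coe_range, Set.mem_Iio] at hj hk
  have := (zmod_eq_iff_of_lt (p := p) (a := 2 * j + 1) (b := 2 * k + 1)
    (by rw [abs_lt]; omega)).1 (by push_cast; exact h)
  omega

theorem two_mul_add_one_ne_neg (hpm : p = 2 * m + 1) :
    ∀ j ∈ range m, ∀ k ∈ range m, 2 * (j : ZMod p) + 1 ≠ -(2 * (k : ZMod p) + 1) := by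
  intro j hj k hk h
  simp only [mem_range] at hj hk
  have := (zmod_eq_iff_of_lt (p := p) (a := 2 * j + 1) (b := -(2 * k + 1))
    (by rw [abs_lt]; omega)).1 (by push_cast; exact h)
  omega

theorem two_mul_add_one_ne_zero (hpm : p = 2 * m + 1) {j : ℕ} (hj : j < 2 * m + 1) (hjm : j ≠ m) :
    2 * (j : ZMod p) + 1 ≠ 0 := by
  intro h
  have := (zmod_eq_iff_of_lt (p := p) (a := 2 * j + 1) (b := 0)
    (by rw [abs_lt]; omega)).1 (by push_cast; exact h)
  omega

theorem natCast_zmod_ne_zero {j : ℕ} (h0 : 0 < j) (hj : j < p) : (j : ZMod p) ≠ 0 := by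
  rw [Ne, ZMod.natCast_eq_zero_iff]
  exact fun h => absurd (Nat.le_of_dvd h0 h) (by omega)

theorem two_mul_add_one_zmod_eq_zero (hpm : p = 2 * m + 1) : 2 * (m : ZMod p) + 1 = 0 := by
  have : ((2 * m + 1 : ℕ) : ZMod p) = 0 := by rw [← hpm, ZMod.natCast_self]
  exact_mod_cast this

theorem ratReduces_two_mul_add_one (j : ℕ) :
    RatReduces p (2 * (j : ℚ) + 1) (2 * (j : ZMod p) + 1) :=
  (RatReduces.two.mul (RatReduces.natCast j)).add RatReduces.one

/-- The summand with index `r` in the interpolation formula for the sum of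
`(3 * n + 1) / (-8) ^ n * (2 * n).choose n ^ 3`. -/
noncomputable def halfTerm (m r : ℕ) : ℚ :=
  (-1) ^ r * (2 * r + 1) * (∏ j ∈ range m, (1 - (2 * (r : ℚ) + 1) ^ 2 / (j + 1) ^ 2)) *
    ∏ s ∈ (range (m + 1)).erase r,
      (2 * (s : ℚ) + 1) ^ 2 / ((2 * s + 1) ^ 2 - (2 * r + 1) ^ 2)

theorem halfTerm_self (hpm : p = 2 * m + 1) (hp : 3 < p) :
    ∃ x, RatReduces p x 0 ∧ halfTerm m m = (-1) ^ m * p + p ^ 3 * x := by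
  have h1 : OneAddSqReduces p (∏ j ∈ range m, (1 - (2 * (m : ℚ) + 1) ^ 2 / (j + 1) ^ 2)) 0 := by
    have := OneAddSqReduces.prod (p := p) (s := range m)
      (f := fun j => 1 - (2 * (m : ℚ) + 1) ^ 2 / (j + 1) ^ 2)
      (g := fun j => -(1 / ((j : ZMod p) + 1) ^ 2)) (fun j hj => by
        rw [← natCast_eq_two_mul_add_one hpm, ← mul_one_div]
        refine OneAddSqReduces.one_sub (RatReduces.one.div
          (((RatReduces.natCast j).add RatReduces.one).pow 2) (pow_ne_zero 2 ?_))
        rw [mem_range] at hj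
        exact_mod_cast natCast_zmod_ne_zero (p := p) (j := j + 1) (by omega) (by omega))
    rwa [sum_neg_distrib, sum_half_inv_sq hp (injOn_natCast_add_one_half hpm)
      (natCast_add_one_ne_neg_half hpm) (by rw [card_range]; omega), neg_zero] at this
  have h2 : OneAddSqReduces p (∏ s ∈ (range (m + 1)).erase m,
      (2 * (s : ℚ) + 1) ^ 2 / ((2 * s + 1) ^ 2 - (2 * m + 1) ^ 2)) 0 := by
    rw [range_add_one, erase_insert (by simp)]
    have := OneAddSqReduces.prod (p := p) (s := range m)
      (f := fun s => (2 * (s : ℚ) + 1) ^ 2 / ((2 * s + 1) ^ 2 - (2 * m + 1) ^ 2))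
      (g := fun s => - -(1 / (2 * (s : ZMod p) + 1) ^ 2)) (fun s hs => by
        have hs0 : 2 * (s : ℚ) + 1 ≠ 0 := by positivity
        rw [← inv_div, sub_div, div_self (pow_ne_zero 2 hs0), ← natCast_eq_two_mul_add_one hpm,
          ← mul_one_div (_ ^ 2)]
        refine (OneAddSqReduces.one_sub (RatReduces.one.div
          ((ratReduces_two_mul_add_one s).pow 2) (pow_ne_zero 2 ?_))).inv
        rw [mem_range] at hs
        exact two_mul_add_one_ne_zero hpm (by omega) (by omega))
    simp only [neg_neg] at this
    rwa [sum_half_inv_sq hp ((injOn_two_mul_add_one hpm).mono (by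
      rw [coe_range, coe_range]; exact Set.Iio_subset_Iio (by omega)))
      (two_mul_add_one_ne_neg hpm) (by rw [card_range]; omega)] at this
  obtain ⟨z, hz, hz'⟩ := h1.mul h2
  refine ⟨(-1) ^ m * z, by simpa using (RatReduces.one.neg.pow m).mul hz, ?_⟩
  rw [halfTerm, mul_assoc, hz', ← natCast_eq_two_mul_add_one hpm]
  ring

theorem prod_erase_inv_one_sub_sq_eq {S : Finset ℕ} (r : ℕ) :
    ∏ s ∈ S, (2 * (s : ℚ) + 1) ^ 2 / ((2 * s + 1) ^ 2 - (2 * r + 1) ^ 2) =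
      (∏ s ∈ S, (1 - (2 * (r : ℚ) + 1) ^ 2 / (2 * s + 1) ^ 2))⁻¹ := by
  rw [← prod_inv_distrib]
  refine prod_congr rfl fun s _ => ?_
  have hs0 : 2 * (s : ℚ) + 1 ≠ 0 := by positivity
  rw [← inv_div, sub_div, div_self (pow_ne_zero 2 hs0)]

theorem halfTerm_eq_zero {i : ℕ} (hi : i < m) (him : m < 2 * (i + 1)) :
    halfTerm m (m - 1 - i) = 0 := by
  rw [halfTerm, prod_eq_zero (i := 2 * (m - 1 - i)) (mem_range.2 (by omega)), mul_zero, zero_mul]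
  push_cast
  rw [div_self (by positivity), sub_self]

theorem halfTerm_of_two_mul_le (hpm : p = 2 * m + 1) (hp : 3 < p) {i : ℕ}
    (him : 2 * (i + 1) ≤ m) :
    ∃ x, RatReduces p x ((-1) ^ m * ((-1) ^ (i + 1) / (2 * ((i : ZMod p) + 1) ^ 2))) ∧
      halfTerm m (m - 1 - i) = p ^ 3 * x := by
  obtain ⟨r, hr⟩ : ∃ r, m = r + i + 1 := ⟨m - 1 - i, by omega⟩
  have hr' : m - 1 - i = r := by omega
  have hi0 : (i : ZMod p) + 1 ≠ 0 := by
    exact_mod_cast natCast_zmod_ne_zero (p := p) (j := i + 1) (by omega) (by omega)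
  have h20 : (2 : ZMod p) ≠ 0 := by
    exact_mod_cast natCast_zmod_ne_zero (p := p) (j := 2) (by omega) (by omega)
  have hm0 := two_mul_add_one_zmod_eq_zero hpm
  have hα : 2 * (r : ZMod p) + 1 = -(2 * ((i : ZMod p) + 1)) := by
    rw [hr] at hm0
    push_cast at hm0
    linear_combination hm0
  have hpr : (p : ℚ) = 2 * r + 1 + 2 * (i + 1) := by
    rw [hpm, hr]
    push_cast
    ring
  have hα0 : 2 * (r : ZMod p) + 1 ≠ 0 := two_mul_add_one_ne_zero hpm (by omega) (by omega)
  have hR1 : RatReduces p (∏ j ∈ (range m).erase (2 * i + 1),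
      (1 - (2 * (r : ℚ) + 1) ^ 2 / (j + 1) ^ 2)) (-1 / 2) := by
    rw [← prod_half_erase_one_sub_sq (by omega) (injOn_natCast_add_one_half hpm)
      (natCast_add_one_ne_neg_half hpm) (by rw [card_range]; omega)
      (x := 2 * (r : ZMod p) + 1) (s₀ := 2 * i + 1) (by rw [mem_range]; omega)
      (Or.inr (by rw [hα]; push_cast; ring))]
    refine RatReduces.prod fun j hj => RatReduces.one.sub
      (((ratReduces_two_mul_add_one r).pow 2).div
        (((RatReduces.natCast j).add RatReduces.one).pow 2) (pow_ne_zero 2 ?_))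
    have hj := mem_range.1 (mem_of_mem_erase hj)
    exact_mod_cast natCast_zmod_ne_zero (p := p) (j := j + 1) (by omega) (by omega)
  have hR2 : RatReduces p (∏ s ∈ (range m).erase r,
      (2 * (s : ℚ) + 1) ^ 2 / ((2 * s + 1) ^ 2 - (2 * r + 1) ^ 2)) (-1 / 2)⁻¹ := by
    rw [prod_erase_inv_one_sub_sq_eq]
    refine RatReduces.inv ?_ (div_ne_zero (neg_ne_zero.2 one_ne_zero) h20)
    rw [← prod_half_erase_one_sub_sq (by omega) ((injOn_two_mul_add_one hpm).mono (by
      rw [coe_range, coe_range]; exact Set.Iio_subset_Iio (by omega)))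
      (two_mul_add_one_ne_neg hpm) (by rw [card_range]; omega)
      (x := 2 * (r : ZMod p) + 1) (s₀ := r) (by rw [mem_range]; omega) (Or.inl rfl)]
    refine RatReduces.prod fun s hs => RatReduces.one.sub
      (((ratReduces_two_mul_add_one r).pow 2).div
        ((ratReduces_two_mul_add_one s).pow 2) (pow_ne_zero 2 ?_))
    have hs := mem_range.1 (mem_of_mem_erase hs)
    exact two_mul_add_one_ne_zero hpm (by omega) (by omega)
  have hRi : RatReduces p ((i : ℚ) + 1) ((i : ZMod p) + 1) :=
    (RatReduces.natCast i).add RatReduces.one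
  have hRr := ratReduces_two_mul_add_one (p := p) r
  have h40 : (4 : ZMod p) * ((i : ZMod p) + 1) ^ 2 ≠ 0 := by
    rw [show (4 : ZMod p) = 2 * 2 by norm_num]
    exact mul_ne_zero (mul_ne_zero h20 h20) (pow_ne_zero 2 hi0)
  have hd0 : (0 : ZMod p) ^ 2 - (2 * (r : ZMod p) + 1) ^ 2 ≠ 0 := by
    simpa using hα0
  have hR := (((RatReduces.one.neg.pow r).mul hRr).mul
    (((((RatReduces.four.mul hRi).sub RatReduces.self).div
      (RatReduces.four.mul (hRi.pow 2)) h40).mul hR1))).mul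
    ((RatReduces.one.div ((RatReduces.self.pow 2).sub (hRr.pow 2)) hd0).mul hR2)
  refine ⟨_, hR.of_eq ?_, ?_⟩
  rotate_left
  · rw [hr', halfTerm, range_add_one, erase_insert_of_ne (by omega),
      prod_insert (by simp), ← natCast_eq_two_mul_add_one hpm,
      ← mul_prod_erase (range m) _ (mem_range.2 (by omega : 2 * i + 1 < m))]
    have e : (1 - (2 * (r : ℚ) + 1) ^ 2 / (((2 * i + 1 : ℕ) : ℚ) + 1) ^ 2) =
        p * ((4 * ((i : ℚ) + 1) - p) / (4 * (i + 1) ^ 2)) := by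
      have : (i : ℚ) + 1 ≠ 0 := by positivity
      have : 2 * (i : ℚ) + 1 + 1 ≠ 0 := by positivity
      rw [hpr]
      push_cast
      field_simp
      ring
    rw [e, show ∀ a b c d f g : ℚ, p ^ 3 * (a * b * (c * d) * (1 / f * g)) =
      a * b * (p * c * d) * (p ^ 2 / f * g) by intros; ring]
  · have hsign : (-1 : ZMod p) ^ m * (-1) ^ (i + 1) = (-1) ^ r := by
      rw [hr, ← pow_add, show r + i + 1 + (i + 1) = r + 2 * (i + 1) by ring, pow_add, pow_mul]
      simp
    have h4 : (4 : ZMod p) = 2 * 2 := by norm_num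
    rw [hα, ← mul_div_assoc ((-1) ^ m), hsign, h4]
    field_simp
    ring

/-- The summand with index `r` in the interpolation formula for the sum of
`(6 * n + 1) / (-512) ^ n * (2 * n).choose n ^ 3`. -/
noncomputable def fullTerm (m r : ℕ) : ℚ :=
  ZMod.χ₈' (2 * r + 1 : ℕ) * (2 * r + 1) *
    (∏ j ∈ range (2 * m), (1 - (2 * (r : ℚ) + 1) ^ 2 / (16 * (j + 1) ^ 2))) *
    ∏ s ∈ (range (2 * m + 1)).erase r,
      (2 * (s : ℚ) + 1) ^ 2 / ((2 * s + 1) ^ 2 - (2 * r + 1) ^ 2)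

theorem four_zmod_ne_zero (hp : 3 < p) : (4 : ZMod p) ≠ 0 := by
  have h2 : ((2 : ℕ) : ZMod p) ≠ 0 := natCast_zmod_ne_zero (by omega) (by omega)
  rw [show (4 : ZMod p) = (2 : ℕ) * (2 : ℕ) by norm_num]
  exact mul_ne_zero h2 h2

theorem injOn_four_mul (hpm : p = 2 * m + 1) (hp : 3 < p) :
    Set.InjOn (fun j : ℕ => 4 * ((j : ZMod p) + 1)) (range (2 * m)) := by
  intro j hj k hk h
  simp only [coe_range, Set.mem_Iio] at hj hk
  have h := mul_left_cancel₀ (four_zmod_ne_zero hp) h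
  have := (zmod_eq_iff_of_lt (p := p) (a := j + 1) (b := k + 1)
    (by rw [abs_lt]; omega)).1 (by push_cast; exact h)
  omega

theorem four_mul_ne_zero (hpm : p = 2 * m + 1) (hp : 3 < p) :
    ∀ j ∈ range (2 * m), 4 * ((j : ZMod p) + 1) ≠ 0 := by
  intro j hj
  rw [mem_range] at hj
  refine mul_ne_zero (four_zmod_ne_zero hp) ?_
  exact_mod_cast natCast_zmod_ne_zero (p := p) (j := j + 1) (by omega) (by omega)

theorem fullTerm_self (hpm : p = 2 * m + 1) (hp : 3 < p) :
    ∃ x, RatReduces p x 0 ∧ fullTerm m m = ZMod.χ₈' p * p + p ^ 3 * x := by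
  have h16 (j : ℕ) : 16 * ((j : ℚ) + 1) ^ 2 = (4 * (j + 1)) ^ 2 := by ring
  have h1 : OneAddSqReduces p
      (∏ j ∈ range (2 * m), (1 - (2 * (m : ℚ) + 1) ^ 2 / (16 * (j + 1) ^ 2))) 0 := by
    have := OneAddSqReduces.prod (p := p) (s := range (2 * m))
      (f := fun j => 1 - (2 * (m : ℚ) + 1) ^ 2 / (16 * (j + 1) ^ 2))
      (g := fun j => -(1 / (4 * ((j : ZMod p) + 1)) ^ 2)) (fun j hj => by
        rw [← natCast_eq_two_mul_add_one hpm, ← mul_one_div, h16]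
        exact OneAddSqReduces.one_sub (RatReduces.one.div
          ((RatReduces.four.mul ((RatReduces.natCast j).add RatReduces.one)).pow 2)
          (pow_ne_zero 2 (four_mul_ne_zero hpm hp j hj))))
    rwa [sum_neg_distrib, sum_eq_sum_univ_erase_zero (injOn_four_mul hpm hp)
      (four_mul_ne_zero hpm hp) (by rw [card_range]; omega) (fun y => 1 / y ^ 2),
      sum_univ_erase_zero_inv_sq hp, neg_zero] at this
  have h2 : OneAddSqReduces p (∏ s ∈ (range (2 * m + 1)).erase m,
      (2 * (s : ℚ) + 1) ^ 2 / ((2 * s + 1) ^ 2 - (2 * m + 1) ^ 2)) 0 := by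
    have hne : ∀ s ∈ (range (2 * m + 1)).erase m, 2 * (s : ZMod p) + 1 ≠ 0 := fun s hs =>
      two_mul_add_one_ne_zero hpm (mem_range.1 (mem_of_mem_erase hs)) (ne_of_mem_erase hs)
    rw [prod_erase_inv_one_sub_sq_eq, ← neg_zero]
    refine OneAddSqReduces.inv ?_
    have := OneAddSqReduces.prod (p := p) (s := (range (2 * m + 1)).erase m)
      (f := fun s => 1 - (2 * (m : ℚ) + 1) ^ 2 / (2 * s + 1) ^ 2)
      (g := fun s => -(1 / (2 * (s : ZMod p) + 1) ^ 2)) (fun s hs => by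
        rw [← natCast_eq_two_mul_add_one hpm, ← mul_one_div]
        exact OneAddSqReduces.one_sub (RatReduces.one.div
          ((ratReduces_two_mul_add_one s).pow 2) (pow_ne_zero 2 (hne s hs))))
    rwa [sum_neg_distrib, sum_eq_sum_univ_erase_zero
      ((injOn_two_mul_add_one hpm).mono (coe_subset.2 (erase_subset _ _))) hne
      (by rw [card_erase_of_mem (by rw [mem_range]; omega), card_range]; omega)
      (fun y => 1 / y ^ 2), sum_univ_erase_zero_inv_sq hp, neg_zero] at this
  obtain ⟨z, hz, hz'⟩ := h1.mul h2
  refine ⟨ZMod.χ₈' p * z, by simpa using (RatReduces.intCast _).mul hz, ?_⟩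
  rw [fullTerm, mul_assoc, hz', ← natCast_eq_two_mul_add_one hpm, ← hpm]
  ring

theorem fullTerm_of_ne (hpm : p = 2 * m + 1) (hp : 3 < p) {r j₁ j₂ : ℕ} (hr : r < 2 * m + 1)
    (hrm : r ≠ m) (hj₁ : j₁ < 2 * m) (hj₂ : j₂ < 2 * m) {u₁ u₂ : ℤ}
    (h₁ : 4 * (j₁ + 1 : ℤ) + (2 * r + 1) = u₁ * p) (h₂ : 4 * (j₂ + 1 : ℤ) - (2 * r + 1) = u₂ * p) :
    ∃ x, RatReduces p x (-(ZMod.χ₈' (2 * r + 1 : ℕ) * (u₁ * u₂) / (2 * (r : ZMod p) + 1) ^ 2)) ∧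
      fullTerm m r = p ^ 3 * x := by
  have h4 := four_zmod_ne_zero hp
  have h2 : (2 : ZMod p) ≠ 0 := by
    exact_mod_cast natCast_zmod_ne_zero (p := p) (j := 2) (by omega) (by omega)
  have hα0 : 2 * (r : ZMod p) + 1 ≠ 0 := two_mul_add_one_ne_zero hpm hr hrm
  have hm0 := two_mul_add_one_zmod_eq_zero hpm
  have c₁ : 4 * ((j₁ : ZMod p) + 1) = -(2 * (r : ZMod p) + 1) := by
    have := congrArg (Int.cast (R := ZMod p)) h₁
    push_cast [ZMod.natCast_self] at this
    linear_combination this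
  have c₂ : 4 * ((j₂ : ZMod p) + 1) = 2 * (r : ZMod p) + 1 := by
    have := congrArg (Int.cast (R := ZMod p)) h₂
    push_cast [ZMod.natCast_self] at this
    linear_combination this
  have q₁ : 4 * ((j₁ : ℚ) + 1) + (2 * r + 1) = u₁ * p := by exact_mod_cast h₁
  have q₂ : 4 * ((j₂ : ℚ) + 1) - (2 * r + 1) = u₂ * p := by exact_mod_cast h₂
  have h12 : j₁ ≠ j₂ := by
    rintro rfl
    refine mul_ne_zero h2 hα0 ?_
    linear_combination c₁ - c₂
  obtain ⟨s₂, hs₂⟩ : ∃ s₂, s₂ + r = 2 * m := ⟨2 * m - r, by omega⟩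
  have hs₂q : 2 * (s₂ : ℚ) + 1 = 2 * p - (2 * r + 1) := by
    have : (s₂ : ℚ) + r = 2 * m := by exact_mod_cast hs₂
    rw [natCast_eq_two_mul_add_one hpm]
    linear_combination 2 * this
  have hs₂z : 2 * (s₂ : ZMod p) + 1 = -(2 * r + 1) := by
    have := congrArg (Nat.cast (R := ZMod p)) hs₂
    push_cast at this
    linear_combination 2 * this + 2 * hm0
  have hR1 : RatReduces p (∏ j ∈ ((range (2 * m)).erase j₁).erase j₂,
      (1 - (2 * (r : ℚ) + 1) ^ 2 / (16 * (j + 1) ^ 2))) (1 / 4) := by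
    rw [← prod_erase_erase_one_sub_sq (by omega) (injOn_four_mul hpm hp)
      (four_mul_ne_zero hpm hp) (by rw [card_range]; omega)
      (x := -(2 * (r : ZMod p) + 1)) h12 (mem_range.2 hj₁) (mem_range.2 hj₂) c₁
      (by rw [neg_neg, c₂]), neg_sq]
    refine RatReduces.prod fun j hj => ?_
    rw [show 16 * ((j : ℚ) + 1) ^ 2 = (4 * (j + 1)) ^ 2 by ring]
    exact RatReduces.one.sub (((ratReduces_two_mul_add_one r).pow 2).div
        ((RatReduces.four.mul ((RatReduces.natCast j).add RatReduces.one)).pow 2) (pow_ne_zero 2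
          (four_mul_ne_zero hpm hp j (mem_of_mem_erase (mem_of_mem_erase hj)))))
  have hR2 : RatReduces p (∏ s ∈ (((range (2 * m + 1)).erase m).erase r).erase s₂,
      (2 * (s : ℚ) + 1) ^ 2 / ((2 * s + 1) ^ 2 - (2 * r + 1) ^ 2)) (1 / 4)⁻¹ := by
    have hne : ∀ s ∈ (range (2 * m + 1)).erase m, 2 * (s : ZMod p) + 1 ≠ 0 := fun s hs =>
      two_mul_add_one_ne_zero hpm (mem_range.1 (mem_of_mem_erase hs)) (ne_of_mem_erase hs)
    rw [prod_erase_inv_one_sub_sq_eq]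
    refine RatReduces.inv ?_ (one_div_ne_zero h4)
    rw [← prod_erase_erase_one_sub_sq (by omega)
      ((injOn_two_mul_add_one hpm).mono (coe_subset.2 (erase_subset _ _))) hne
      (by rw [card_erase_of_mem (by rw [mem_range]; omega), card_range]; omega)
      (x := 2 * (r : ZMod p) + 1) (by omega : r ≠ s₂)
      (mem_erase.2 ⟨hrm, mem_range.2 hr⟩)
      (mem_erase.2 ⟨by omega, mem_range.2 (by omega)⟩) rfl hs₂z]
    exact RatReduces.prod fun s hs => RatReduces.one.sub
      (((ratReduces_two_mul_add_one r).pow 2).div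
        ((ratReduces_two_mul_add_one s).pow 2) (pow_ne_zero 2
          (hne s (mem_of_mem_erase (mem_of_mem_erase hs)))))
  have hRr := ratReduces_two_mul_add_one (p := p) r
  have hRs := ratReduces_two_mul_add_one (p := p) s₂
  have hRj (j : ℕ) : RatReduces p (4 * ((j : ℚ) + 1)) (4 * ((j : ZMod p) + 1)) :=
    RatReduces.four.mul ((RatReduces.natCast j).add RatReduces.one)
  have hd0 : (0 : ZMod p) ^ 2 - (2 * (r : ZMod p) + 1) ^ 2 ≠ 0 := by
    simpa using hα0
  have hd1 : (4 : ZMod p) * (0 - (2 * (r : ZMod p) + 1)) ≠ 0 := by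
    rw [zero_sub]
    exact mul_ne_zero h4 (neg_ne_zero.2 hα0)
  have hR := (((RatReduces.intCast (p := p) (ZMod.χ₈' (2 * r + 1 : ℕ))).mul hRr).mul
    ((((RatReduces.intCast u₁).mul ((hRj j₁).sub hRr)).div ((hRj j₁).pow 2)
      (pow_ne_zero 2 (four_mul_ne_zero hpm hp j₁ (mem_range.2 hj₁)))).mul
    ((((RatReduces.intCast u₂).mul ((hRj j₂).add hRr)).div ((hRj j₂).pow 2)
      (pow_ne_zero 2 (four_mul_ne_zero hpm hp j₂ (mem_range.2 hj₂)))).mul hR1))).mul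
    ((RatReduces.one.div ((RatReduces.self.pow 2).sub (hRr.pow 2)) hd0).mul
    (((hRs.pow 2).div (RatReduces.four.mul (RatReduces.self.sub hRr)) hd1).mul hR2))
  refine ⟨_, hR.of_eq ?_, ?_⟩
  rotate_left
  · have hp0 : (p : ℚ) ≠ 0 := by rw [natCast_eq_two_mul_add_one hpm]; positivity
    have hpr : (p : ℚ) - (2 * r + 1) ≠ 0 :=
      (RatReduces.self.sub hRr).ne_zero (by rwa [zero_sub, neg_ne_zero])
    rw [fullTerm, ← mul_prod_erase (range (2 * m)) _ (mem_range.2 hj₁),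
      ← mul_prod_erase ((range (2 * m)).erase j₁) _ (mem_erase.2 ⟨h12.symm, mem_range.2 hj₂⟩),
      ← mul_prod_erase ((range (2 * m + 1)).erase r) (a := m) _
        (mem_erase.2 ⟨hrm.symm, mem_range.2 (by omega)⟩), erase_right_comm (a := r),
      ← mul_prod_erase (((range (2 * m + 1)).erase m).erase r) (a := s₂) _
        (mem_erase.2 ⟨by omega, mem_erase.2 ⟨by omega, mem_range.2 (by omega)⟩⟩),
      ← natCast_eq_two_mul_add_one hpm]
    have e₁ : 1 - (2 * (r : ℚ) + 1) ^ 2 / (16 * (j₁ + 1) ^ 2) =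
        p * (u₁ * (4 * ((j₁ : ℚ) + 1) - (2 * r + 1)) / (4 * (j₁ + 1)) ^ 2) := by
      have : 4 * ((j₁ : ℚ) + 1) ≠ 0 := by positivity
      rw [show 16 * ((j₁ : ℚ) + 1) ^ 2 = (4 * (j₁ + 1)) ^ 2 by ring,
        one_sub_div (pow_ne_zero 2 this), ← mul_div_assoc]
      congr 1
      linear_combination (4 * ((j₁ : ℚ) + 1) - (2 * r + 1)) * q₁
    have e₂ : 1 - (2 * (r : ℚ) + 1) ^ 2 / (16 * (j₂ + 1) ^ 2) =
        p * (u₂ * (4 * ((j₂ : ℚ) + 1) + (2 * r + 1)) / (4 * (j₂ + 1)) ^ 2) := by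
      have : 4 * ((j₂ : ℚ) + 1) ≠ 0 := by positivity
      rw [show 16 * ((j₂ : ℚ) + 1) ^ 2 = (4 * (j₂ + 1)) ^ 2 by ring,
        one_sub_div (pow_ne_zero 2 this), ← mul_div_assoc]
      congr 1
      linear_combination (4 * ((j₂ : ℚ) + 1) + (2 * r + 1)) * q₂
    have e₃ : (2 * (s₂ : ℚ) + 1) ^ 2 / ((2 * s₂ + 1) ^ 2 - (2 * r + 1) ^ 2) =
        1 / p * ((2 * (s₂ : ℚ) + 1) ^ 2 / (4 * (p - (2 * r + 1)))) := by
      rw [one_div_mul_eq_div, div_div]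
      congr 1
      rw [hs₂q]
      ring
    have key (a A B P D E Q : ℚ) : a * (p * A * (p * B * P)) * (p ^ 2 / D * (1 / p * E * Q)) =
        p ^ 3 * (a * (A * (B * P)) * (1 / D * (E * Q))) := by
      field_simp
    rw [e₁, e₂, e₃]
    exact key _ _ _ _ _ _ _
  · rw [c₁, c₂, hs₂z]
    field_simp
    ring

theorem chi_add_four_mul (n k : ℕ) :
    ZMod.χ₈' ((n + 4 * k : ℕ) : ZMod 8) = (-1) ^ k * ZMod.χ₈' (n : ZMod 8) := by
  have h : ∀ x : ZMod 8, ZMod.χ₈' (x + 4) = -ZMod.χ₈' x := by decide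
  induction k with
  | zero => simp
  | succ k ih =>
    rw [show n + 4 * (k + 1) = n + 4 * k + 4 by ring, Nat.cast_add (n + 4 * k), Nat.cast_ofNat, h,
      ih]
    ring

theorem fullTerm_add_fullTerm (hpm : p = 2 * m + 1) (hp : 3 < p) {i : ℕ} (hi : i < m) :
    ∃ x, RatReduces p x (if Even (i + 1) then
        ZMod.χ₈' p * ((-1) ^ ((i + 1) / 2) / (2 * ((i : ZMod p) + 1) ^ 2)) else 0) ∧
      fullTerm m (m - 1 - i) + fullTerm m (m + 1 + i) = p ^ 3 * x := by
  obtain ⟨r, hr⟩ : ∃ r, m = r + i + 1 := ⟨m - 1 - i, by omega⟩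
  have hi0 : (i : ZMod p) + 1 ≠ 0 := by
    exact_mod_cast natCast_zmod_ne_zero (p := p) (j := i + 1) (by omega) (by omega)
  have h20 : (2 : ZMod p) ≠ 0 := by
    exact_mod_cast natCast_zmod_ne_zero (p := p) (j := 2) (by omega) (by omega)
  have hm0 := two_mul_add_one_zmod_eq_zero hpm
  have hα₁ : 2 * (r : ZMod p) + 1 = -(2 * ((i : ZMod p) + 1)) := by
    rw [hr] at hm0
    push_cast at hm0
    linear_combination hm0
  have hα₂ : 2 * ((m + 1 + i : ℕ) : ZMod p) + 1 = 2 * ((i : ZMod p) + 1) := by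
    push_cast
    linear_combination hm0
  have hrm : m - 1 - i = r := by omega
  rw [hrm]
  rcases Nat.even_or_odd' (i + 1) with ⟨t, ht | ht⟩
  · obtain ⟨k, rfl⟩ : ∃ k, t = k + 1 := ⟨t - 1, by omega⟩
    obtain ⟨x₁, hx₁, e₁⟩ := fullTerm_of_ne hpm hp (r := r) (j₁ := k) (j₂ := 2 * m - k - 1)
      (u₁ := 1) (u₂ := 3) (by omega) (by omega) (by omega) (by omega) (by omega) (by omega)
    obtain ⟨x₂, hx₂, e₂⟩ := fullTerm_of_ne hpm hp (r := m + 1 + i) (j₁ := 2 * m - k - 1) (j₂ := k)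
      (u₁ := 5) (u₂ := -1) (by omega) (by omega) (by omega) (by omega) (by omega) (by omega)
    refine ⟨x₁ + x₂, (hx₁.add hx₂).of_eq ?_, by rw [e₁, e₂]; ring⟩
    have hs : ((-1 : ZMod p) ^ (k + 1)) ^ 2 = 1 := by rw [← pow_mul, mul_comm, pow_mul]; simp
    have hχ : ZMod.χ₈' (p : ZMod 8) = (-1) ^ (k + 1) * ZMod.χ₈' ((2 * r + 1 : ℕ) : ZMod 8) := by
      rw [← chi_add_four_mul, show 2 * r + 1 + 4 * (k + 1) = p by omega]
    rw [if_pos ⟨k + 1, by omega⟩, hα₁, hα₂, hχ,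
      show 2 * (m + 1 + i) + 1 = 2 * r + 1 + 4 * (2 * (k + 1)) by omega, chi_add_four_mul,
      ht, Nat.mul_div_cancel_left _ two_pos, pow_mul]
    push_cast
    field_simp
    linear_combination -2 * ((ZMod.χ₈' (2 * (r : ZMod 8) + 1) : ℤ) : ZMod p) * hs
  · obtain ⟨x₁, hx₁, e₁⟩ := fullTerm_of_ne hpm hp (r := r) (j₁ := m + t) (j₂ := m - t - 1)
      (u₁ := 3) (u₂ := 1) (by omega) (by omega) (by omega) (by omega) (by omega) (by omega)
    obtain ⟨x₂, hx₂, e₂⟩ := fullTerm_of_ne hpm hp (r := m + 1 + i) (j₁ := m - t - 1) (j₂ := m + t)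
      (u₁ := 3) (u₂ := 1) (by omega) (by omega) (by omega) (by omega) (by omega) (by omega)
    refine ⟨x₁ + x₂, (hx₁.add hx₂).of_eq ?_, by rw [e₁, e₂]; ring⟩
    rw [if_neg (Nat.not_even_iff_odd.2 ⟨t, ht⟩), hα₁, hα₂,
      show 2 * (m + 1 + i) + 1 = 2 * r + 1 + 4 * (2 * t + 1) by omega, chi_add_four_mul,
      pow_succ (-1 : ℤ), pow_mul (-1 : ℤ)]
    push_cast
    field_simp
    ring

theorem sum_halfTerm (hpm : p = 2 * m + 1) (hp : 3 < p) :
    ∃ x, RatReduces p x ((-1) ^ m * ∑ i ∈ range m,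
        if 2 * (i + 1) ≤ m then (-1) ^ (i + 1) / (2 * ((i : ZMod p) + 1) ^ 2) else 0) ∧
      ∑ r ∈ range (m + 1), halfTerm m r = (-1) ^ m * p + p ^ 3 * x := by
  obtain ⟨x, hx, ex⟩ := halfTerm_self hpm hp
  obtain ⟨y, hy, ey⟩ := RatReduces.exists_sum_eq_mul (p := p) (s := range m)
    (f := fun i => halfTerm m (m - 1 - i)) (g := fun i => (-1) ^ m *
      if 2 * (i + 1) ≤ m then (-1) ^ (i + 1) / (2 * ((i : ZMod p) + 1) ^ 2) else 0) (p ^ 3)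
    (fun i hi => by
      split_ifs with him
      · exact halfTerm_of_two_mul_le hpm hp him
      · refine ⟨0, by simpa using RatReduces.zero, ?_⟩
        rw [mul_zero, halfTerm_eq_zero (mem_range.1 hi) (by omega)])
  rw [sum_range_reflect (fun r => halfTerm m r)] at ey
  refine ⟨x + y, (hx.add hy).of_eq (by rw [zero_add, mul_sum]), ?_⟩
  rw [sum_range_succ, ex, ey]
  ring

theorem sum_fullTerm (hpm : p = 2 * m + 1) (hp : 3 < p) :
    ∃ x, RatReduces p x (ZMod.χ₈' p * ∑ i ∈ range m, if Even (i + 1) then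
        (-1) ^ ((i + 1) / 2) / (2 * ((i : ZMod p) + 1) ^ 2) else 0) ∧
      ∑ r ∈ range (2 * m + 1), fullTerm m r = ZMod.χ₈' p * p + p ^ 3 * x := by
  obtain ⟨x, hx, ex⟩ := fullTerm_self hpm hp
  obtain ⟨y, hy, ey⟩ := RatReduces.exists_sum_eq_mul (p := p) (p ^ 3)
    (fun i hi => fullTerm_add_fullTerm hpm hp (mem_range.1 hi))
  rw [sum_add_distrib, sum_range_reflect (fun r => fullTerm m r)] at ey
  refine ⟨x + y, (hx.add hy).of_eq (by simp only [zero_add, mul_sum, mul_ite, mul_zero]), ?_⟩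
  rw [show 2 * m + 1 = m + 1 + m by ring, sum_range_add, sum_range_succ, ex]
  linear_combination ey

theorem sum_half_eq_four_mul_sum_even (hpm : p = 2 * m + 1) (hp : 3 < p) :
    (∑ i ∈ range m, if 2 * (i + 1) ≤ m then
      (-1) ^ (i + 1) / (2 * ((i : ZMod p) + 1) ^ 2) else 0) =
    4 * ∑ i ∈ range m, if Even (i + 1) then
      (-1) ^ ((i + 1) / 2) / (2 * ((i : ZMod p) + 1) ^ 2) else 0 := by
  have h20 : (2 : ZMod p) ≠ 0 := by
    exact_mod_cast natCast_zmod_ne_zero (p := p) (j := 2) (by omega) (by omega)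
  rw [← sum_filter, ← sum_filter, mul_sum]
  refine sum_nbij' (fun i => 2 * i + 1) (fun k => k / 2) ?_ ?_ ?_ ?_ ?_
  · intro i hi
    simp only [mem_filter, mem_range] at hi ⊢
    exact ⟨by omega, i + 1, by ring⟩
  · intro k hk
    simp only [mem_filter, mem_range, Nat.even_iff] at hk ⊢
    omega
  · intro i _
    omega
  · intro k hk
    simp only [mem_filter, mem_range, Nat.even_iff] at hk ⊢
    omega
  · intro i hi
    simp only [mem_filter, mem_range] at hi
    have hi0 : (i : ZMod p) + 1 ≠ 0 := by
      exact_mod_cast natCast_zmod_ne_zero (p := p) (j := i + 1) (by omega) (by omega)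
    have e : ((2 * i + 1 : ℕ) : ZMod p) + 1 = 2 * (i + 1) := by
      push_cast
      ring
    rw [show 2 * i + 1 + 1 = 2 * (i + 1) by ring, Nat.mul_div_cancel_left _ two_pos, e,
      show (4 : ZMod p) = 2 * 2 by norm_num]
    field_simp

end SumsOverNodes

theorem centralBinom_eq_prod (n : ℕ) :
    (n.centralBinom : ℚ) = ∏ j ∈ range n, 2 * (2 * (j : ℚ) + 1) / (j + 1) := by
  induction n with
  | zero => simp
  | succ n ih =>
    have h : ((n : ℚ) + 1) * (n + 1).centralBinom = 2 * (2 * n + 1) * n.centralBinom := by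
      exact_mod_cast Nat.succ_mul_centralBinom_succ n
    have hn : (n : ℚ) + 1 ≠ 0 := by positivity
    rw [prod_range_succ, ← ih]
    field_simp
    linear_combination h

theorem centralBinom_cube_div_pow (d : ℚ) (n : ℕ) :
    ((2 * n).choose n : ℚ) ^ 3 / (-8 * d) ^ n =
      ∏ j ∈ range n, -(2 * (j : ℚ) + 1) ^ 3 / (d * (j + 1) ^ 3) := by
  rw [← Nat.centralBinom_eq_two_mul_choose, centralBinom_eq_prod, ← prod_pow,
    ← card_range n, ← prod_const, card_range, ← prod_div_distrib]
  refine prod_congr rfl fun j _ => ?_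
  have hj : (j : ℚ) + 1 ≠ 0 := by positivity
  field_simp
  ring

theorem injOn_sq_two_mul_add_one (S : Set ℕ) : Set.InjOn (fun j : ℕ => (2 * (j : ℚ) + 1) ^ 2) S := by
  intro j _ k _ h
  have := (sq_eq_sq₀ (by positivity) (by positivity)).1 h
  exact_mod_cast (by linarith : (j : ℚ) = k)

theorem sum_three_mul_add_one_eq_sum_halfTerm (m : ℕ) :
    ∑ n ∈ range (m + 1), (3 * (n : ℚ) + 1) / (-8) ^ n * ((2 * n).choose n : ℚ) ^ 3 =
      ∑ r ∈ range (m + 1), halfTerm m r := by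
  have h := sum_prod_eq_sum_interpolation m (fun n => 3 * (n : ℚ) + 1)
    (fun j => -(2 * (j : ℚ) + 1) ^ 3 / (j + 1) ^ 3) (fun j => (2 * (j : ℚ) + 1) ^ 2)
    (fun j => ((j : ℚ) + 1) ^ 2) (fun r => (-1) ^ r * (2 * r + 1))
    (injOn_sq_two_mul_add_one _) (fun j => by positivity) (fun j => by positivity)
    (fun r j hjr h => by
      have h := (sq_eq_sq₀ (by positivity) (by positivity)).1 h
      have hjr : (j : ℚ) < r := by exact_mod_cast hjr
      linarith) sum_three_mul_add_one_eq
  simp only [halfTerm]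
  rw [← h]
  refine sum_congr rfl fun n _ => ?_
  have := centralBinom_cube_div_pow 1 n
  simp only [mul_one, one_mul] at this
  rw [← this]
  ring

theorem sum_six_mul_add_one_eq_sum_fullTerm (m : ℕ) :
    ∑ n ∈ range (2 * m + 1), (6 * (n : ℚ) + 1) / (-512) ^ n * ((2 * n).choose n : ℚ) ^ 3 =
      ∑ r ∈ range (2 * m + 1), fullTerm m r := by
  have h := sum_prod_eq_sum_interpolation (2 * m) (fun n => 6 * (n : ℚ) + 1)
    (fun j => -(2 * (j : ℚ) + 1) ^ 3 / (64 * (j + 1) ^ 3)) (fun j => (2 * (j : ℚ) + 1) ^ 2)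
    (fun j => 16 * ((j : ℚ) + 1) ^ 2) (fun r => ZMod.χ₈' (2 * r + 1 : ℕ) * (2 * r + 1))
    (injOn_sq_two_mul_add_one _) (fun j => by positivity) (fun j => by positivity)
    (fun r j _ h => by
      rw [show 16 * ((j : ℚ) + 1) ^ 2 = (4 * (j + 1)) ^ 2 by ring] at h
      have h := (sq_eq_sq₀ (by positivity) (by positivity)).1 h
      have h : 4 * (j + 1) = 2 * r + 1 := by exact_mod_cast h
      omega) sum_six_mul_add_one_eq
  simp only [fullTerm]
  rw [← h]
  refine sum_congr rfl fun n _ => ?_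
  have := centralBinom_cube_div_pow 64 n
  norm_num only [] at this
  rw [← this]
  ring

end Interpolation

/-- A conjecture of Z.-W. Sun: for any prime `p > 3`,
`∑_{n=0}^{(p-1)/2} (3n+1)/(-8)^n C(2n,n)³
  ≡ 4(2|p) ∑_{n=0}^{p-1} (6n+1)/(-512)^n C(2n,n)³ - 3p(-1|p) (mod p⁴)`. -/
theorem sum_congr_four_legendre (p : ℕ) [Fact (Nat.Prime p)] (hp : 3 < p) :
    ((p : ℤ)) ^ 4 ∣
      ((∑ n ∈ Finset.range ((p - 1) / 2 + 1),
          (3 * (n : ℚ) + 1) / (-8) ^ n * ((2 * n).choose n : ℚ) ^ 3) -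
        (4 * (legendreSym p 2 : ℚ) *
            (∑ n ∈ Finset.range p,
              (6 * (n : ℚ) + 1) / (-512) ^ n * ((2 * n).choose n : ℚ) ^ 3) -
          3 * (p : ℚ) * (legendreSym p (-1) : ℚ))).num := by
  obtain ⟨m, hpm⟩ : ∃ m, p = 2 * m + 1 := (Fact.out : p.Prime).odd_of_ne_two (by omega)
  have hm : (p - 1) / 2 = m := by omega
  have h2p : p ≠ 2 := by omega
  have hneg : legendreSym p (-1) = (-1) ^ m := by
    rw [legendreSym.at_neg_one h2p, ZMod.χ₄_eq_neg_one_pow (by omega)]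
    congr 1
    omega
  have hchi : legendreSym p 2 * ZMod.χ₈' p = (-1) ^ m := by
    have h2 : ((2 : ℤ) : ZMod p) ≠ 0 := by
      exact_mod_cast natCast_zmod_ne_zero (p := p) (j := 2) (by omega) (by omega)
    rw [← legendreSym.at_neg_two h2p, show (-2 : ℤ) = -1 * 2 by norm_num, legendreSym.mul, hneg]
    linear_combination (-1) ^ m * legendreSym.sq_one p h2
  obtain ⟨x, hx, ex⟩ := sum_halfTerm hpm hp
  obtain ⟨y, hy, ey⟩ := sum_fullTerm hpm hp
  have hchi_rat : (legendreSym p 2 : ℚ) * (ZMod.χ₈' p : ℤ) = (-1) ^ m := by exact_mod_cast hchi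
  have hchi_zmod : ((legendreSym p 2 : ℤ) : ZMod p) * (ZMod.χ₈' p : ℤ) = (-1) ^ m := by
    exact_mod_cast congrArg (Int.cast (R := ZMod p)) hchi
  have key := ((hx.sub ((RatReduces.four.mul
    (RatReduces.intCast (legendreSym p 2))).mul hy)).of_eq (y₂ := 0) (by
      rw [sum_half_eq_four_mul_sum_even hpm hp, ← hchi_zmod]
      ring)).pow_succ_dvd_num 3
  convert key using 3
  rw [hm, sum_three_mul_add_one_eq_sum_halfTerm, ex]
  have hr : Finset.range p = Finset.range (2 * m + 1) := by rw [hpm]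
  rw [hr, sum_six_mul_add_one_eq_sum_fullTerm, ey, hneg]
  push_cast
  linear_combination -(4 * p : ℚ) * hchi_rat
end

section
/- Let p > 3 be a prime. Then 2^{(9p-9)/2} * sum_{k=0}^{(p-3)/2} C((p-1)/2, 2k) * C(2k,k) / 4^k ≡ (-1)^{(p-1)/2} * (1 + 6p*q_p(2) + 15p^2*q_p(2)^2) (mod p^3), where the congruence is between rational numbers whose denominators are coprime to p. -/
open Finset Polynomial in
/-- The central binomial coefficient as a sum over the even terms of `((1 + X ^ 2) + 2 * X) ^ n`. -/
theorem sum_choose_mul_ite_eq_centralBinom (n : ℕ) :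
    ∑ j ∈ range (n + 1), n.choose j * (if 2 ∣ j then j.choose (j / 2) else 0) * 2 ^ (n - j) =
      (2 * n).choose n := by
  have h : ((1 + X) ^ (2 * n) : ℕ[X]) = ((1 + X ^ 2) + 2 * X) ^ n := by
    rw [pow_mul]; congr 1; ring
  have h2 := congrArg (fun f => f.coeff n) h
  simp only [coeff_one_add_X_pow, Nat.cast_id] at h2
  rw [h2, add_pow, finsetSum_coeff]
  refine sum_congr rfl fun j hj => ?_
  have hjn : j ≤ n := by simp at hj; omega
  have h3 : (1 + X ^ 2 : ℕ[X]) ^ j = expand ℕ 2 ((1 + X) ^ j) := by simp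
  have h4 : (1 + X ^ 2 : ℕ[X]) ^ j * (2 * X) ^ (n - j) * (n.choose j : ℕ[X]) =
      C (n.choose j * 2 ^ (n - j)) * ((1 + X ^ 2 : ℕ[X]) ^ j * X ^ (n - j)) := by
    rw [C_mul, C_pow, mul_pow, ← C_eq_natCast]
    simp
    ring
  rw [h4, coeff_C_mul, coeff_mul_X_pow', if_pos (Nat.sub_le _ _), Nat.sub_sub_self hjn, h3,
    coeff_expand two_pos, coeff_one_add_X_pow]
  simp only [Nat.cast_id]
  ring

open Finset in
theorem sum_range_two_mul_of_odd_eq_zero {M : Type*} [AddCommMonoid M] (f : ℕ → M)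
    (hf : ∀ k, f (2 * k + 1) = 0) (n : ℕ) :
    ∑ j ∈ range (2 * n), f j = ∑ k ∈ range n, f (2 * k) := by
  induction n with
  | zero => simp
  | succ n ih => rw [Nat.mul_succ, sum_range_succ, sum_range_succ, sum_range_succ, ih, hf, add_zero]

open Finset in
theorem sum_choose_mul_choose_div_four_pow {n m : ℕ} (hm : n < 2 * m) :
    ∑ k ∈ range m, (n.choose (2 * k) : ℚ) * ((2 * k).choose k : ℚ) / 4 ^ k =
      ((2 * n).choose n : ℚ) / 2 ^ n := by
  rw [eq_div_iff (by positivity), ← sum_choose_mul_ite_eq_centralBinom n, sum_mul]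
  have h := sum_range_two_mul_of_odd_eq_zero
    (fun j => n.choose j * (if 2 ∣ j then j.choose (j / 2) else 0) * 2 ^ (n - j))
    (fun k => by simp [show ¬ 2 ∣ 2 * k + 1 by omega]) m
  have h2 : ∑ j ∈ range (n + 1), n.choose j * (if 2 ∣ j then j.choose (j / 2) else 0) * 2 ^ (n - j)
      = ∑ j ∈ range (2 * m),
        n.choose j * (if 2 ∣ j then j.choose (j / 2) else 0) * 2 ^ (n - j) := by
    refine sum_subset (by intro x; simp; omega) fun j _ hj => ?_
    rw [Nat.choose_eq_zero_of_lt (by simp at hj; omega)]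
    simp
  rw [h2, h]
  push_cast
  refine sum_congr rfl fun k _ => ?_
  rcases le_or_gt (2 * k) n with hk | hk
  · obtain ⟨d, rfl⟩ := Nat.exists_eq_add_of_le hk
    have : (4 : ℚ) ^ k = 2 ^ (2 * k) := by rw [pow_mul]; norm_num
    simp [this, pow_add]
    field_simp
  · simp [Nat.choose_eq_zero_of_lt hk]

open Finset in
theorem ZMod.sum_range_natCast {M : Type*} [AddCommMonoid M] (p : ℕ) [NeZero p] (f : ZMod p → M) :
    ∑ i ∈ range p, f (i : ZMod p) = ∑ x, f x :=
  sum_bij' (fun i _ => (i : ZMod p)) (fun x _ => x.val) (by simp)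
    (fun x _ => by simpa using ZMod.val_lt x)
    (fun i hi => ZMod.val_cast_of_lt (by simpa using hi)) (by simp) (by simp)

open Finset in
/-- The half harmonic sum of order two vanishes modulo a prime `2 * n + 1 > 3`. -/
theorem ZMod.sum_range_inv_sq_eq_zero {p n : ℕ} [Fact p.Prime] (hp : p = 2 * n + 1) (hn : 1 < n) :
    ∑ i ∈ range n, (((i + 1 : ℕ) : ZMod p) ^ 2)⁻¹ = 0 := by
  have h2 : (2 : ZMod p) ≠ 0 := by
    have := (ZMod.natCast_eq_zero_iff 2 p).not.mpr (fun h => by have := Nat.le_of_dvd two_pos h; omega)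
    exact_mod_cast this
  have hall : ∑ x : ZMod p, (x ^ 2)⁻¹ = 0 := by
    rw [← FiniteField.sum_pow_lt_card_sub_one (ZMod p) 2 (by rw [ZMod.card]; omega)]
    exact Fintype.sum_equiv (Equiv.inv (ZMod p)) _ _ (by simp)
  rw [← ZMod.sum_range_natCast p (fun x => (x ^ 2)⁻¹)] at hall
  have hsplit : range p = range (n + n + 1) := by rw [hp, two_mul]
  have hrefl : ∑ i ∈ range n, (((n + i + 1 : ℕ) : ZMod p) ^ 2)⁻¹ =
      ∑ i ∈ range n, (((i + 1 : ℕ) : ZMod p) ^ 2)⁻¹ := by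
    rw [← sum_range_reflect]
    refine sum_congr rfl fun i hi => ?_
    have hneg : ((n + (n - 1 - i) + 1 : ℕ) : ZMod p) = -((i + 1 : ℕ) : ZMod p) := by
      rw [eq_neg_iff_add_eq_zero, ← Nat.cast_add, ZMod.natCast_eq_zero_iff]
      simp only [mem_range] at hi
      exact dvd_of_eq (by omega)
    rw [hneg, neg_sq]
  rw [hsplit, sum_range_succ', sum_range_add, hrefl, ← two_mul] at hall
  simpa [h2] using hall

open Finset in
theorem sq_dvd_prod_add_sub {ι R : Type*} [CommRing R] [DecidableEq ι] (s : Finset ι)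
    (A : ι → R) (c : R) :
    c ^ 2 ∣ ∏ i ∈ s, (A i + c) - ∏ i ∈ s, A i - c * ∑ i ∈ s, ∏ j ∈ s.erase i, A j := by
  induction s using Finset.induction_on with
  | empty => simp
  | insert a s ha ih =>
    obtain ⟨d, hd⟩ := ih
    have : ∑ i ∈ s, ∏ j ∈ (insert a s).erase i, A j = A a * ∑ i ∈ s, ∏ j ∈ s.erase i, A j := by
      rw [mul_sum]
      refine sum_congr rfl fun i hi => ?_
      rw [erase_insert_of_ne (by rintro rfl; exact ha hi), prod_insert (by simp [ha])]
    rw [prod_insert ha, prod_insert ha, sum_insert ha, erase_insert ha, this]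
    refine ⟨(A a + c) * d + ∑ i ∈ s, ∏ j ∈ s.erase i, A j, ?_⟩
    linear_combination (A a + c) * hd

open Finset in
theorem pow_three_dvd_prod_sq_sub {p n : ℕ} (hp : p.Prime) (hpn : p = 2 * n + 1) (hn : 1 < n) :
    (p : ℤ) ^ 3 ∣ (∏ i ∈ range n, (2 * ((i : ℤ) + 1) - p)) ^ 2 -
      ∏ i ∈ range n, (4 * ((i : ℤ) + 1) * (i + 1 - p)) := by
  have := Fact.mk hp
  set A : ℕ → ℤ := fun i => 4 * ((i : ℤ) + 1) * (i + 1 - p) with hA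
  have h1 : (∏ i ∈ range n, (2 * ((i : ℤ) + 1) - p)) ^ 2 = ∏ i ∈ range n, (A i + p ^ 2) := by
    rw [← prod_pow]
    exact prod_congr rfl fun i _ => by simp only [hA]; ring
  have h2 : (p : ℤ) ∣ ∑ i ∈ range n, ∏ j ∈ (range n).erase i, A j := by
    rw [← ZMod.intCast_zmod_eq_zero_iff_dvd]
    have hne : ∀ i ∈ range n, (A i : ZMod p) = 4 * ((i + 1 : ℕ) : ZMod p) ^ 2 ∧ (A i : ZMod p) ≠ 0 := by
      intro i hi
      have e : (A i : ZMod p) = 4 * ((i + 1 : ℕ) : ZMod p) ^ 2 := by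
        simp [hA]; ring
      refine ⟨e, ?_⟩
      have e2 : (A i : ZMod p) = ((2 * (i + 1) : ℕ) : ZMod p) ^ 2 := by
        rw [e]; push_cast; ring
      rw [e2]
      refine pow_ne_zero _ ?_
      rw [Ne, ZMod.natCast_eq_zero_iff]
      intro h
      have := Nat.le_of_dvd (by omega) h
      simp at hi
      omega
    have h3 : ∀ i ∈ range n, ∏ j ∈ (range n).erase i, (A j : ZMod p) =
        (∏ j ∈ range n, (A j : ZMod p)) * (4⁻¹ * (((i + 1 : ℕ) : ZMod p) ^ 2)⁻¹) := by
      intro i hi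
      rw [← mul_inv, ← (hne i hi).1, ← mul_prod_erase _ _ hi]
      field_simp [(hne i hi).2]
    push_cast at h3 ⊢
    rw [sum_congr rfl h3, ← mul_sum, ← mul_sum]
    have := ZMod.sum_range_inv_sq_eq_zero hpn hn
    push_cast at this
    rw [this]; simp
  obtain ⟨d, hd⟩ := sq_dvd_prod_add_sub (range n) A ((p : ℤ) ^ 2)
  obtain ⟨e, he⟩ := h2
  rw [h1]
  refine ⟨e + p * d, ?_⟩
  rw [he] at hd
  linear_combination hd

open Finset in
theorem two_pow_mul_factorial_mul_prod_odd (n : ℕ) :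
    2 ^ n * n.factorial * ∏ i ∈ range n, (2 * i + 1) = (2 * n).factorial := by
  induction n with
  | zero => simp
  | succ n ih =>
    rw [Nat.mul_succ, Nat.factorial_succ (2 * n + 1), Nat.factorial_succ (2 * n), ← ih,
      prod_range_succ, Nat.factorial_succ]
    ring

open Finset in
/-- Morley's congruence. -/
theorem morley_congruence {p n : ℕ} (hp : p.Prime) (hpn : p = 2 * n + 1) (hn : 1 < n) :
    (p : ℤ) ^ 3 ∣ ((2 * n).choose n : ℤ) - (-1) ^ n * 16 ^ n := by
  set T := ∏ i ∈ range n, (2 * ((i : ℤ) + 1) - p) with hT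
  set U := ∏ i ∈ range n, ((i : ℤ) + 1 - p) with hU
  have hfac : ∏ i ∈ range n, ((i : ℤ) + 1) = n.factorial := by
    rw [← prod_range_add_one_eq_factorial]; push_cast; rfl
  have hc : ((2 * n).choose n : ℤ) * n.factorial = (-1) ^ n * U := by
    have := Nat.descFactorial_eq_factorial_mul_choose (2 * n) n
    rw [Nat.descFactorial_eq_prod_range] at this
    rw [mul_comm, ← Nat.cast_mul, ← this, hU, Nat.cast_prod, ← card_range n, ← prod_const,
      card_range, ← prod_mul_distrib]
    refine prod_congr rfl fun i hi => ?_
    simp at hi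
    rw [Nat.cast_sub (by omega), hpn]; push_cast; ring
  have hodd : (-1) ^ n * T = ∏ i ∈ range n, (2 * (i : ℤ) + 1) := by
    rw [← prod_range_reflect, hT]
    nth_rw 1 [← card_range n]
    rw [← prod_const, ← prod_mul_distrib]
    refine prod_congr rfl fun i hi => ?_
    simp at hi
    rw [Nat.sub_sub, Nat.cast_sub (by omega), hpn]; push_cast; ring
  have hn0 : (n.factorial : ℤ) ≠ 0 := by exact_mod_cast n.factorial_ne_zero
  have hs : ((-1 : ℤ) ^ n) * (-1) ^ n = 1 := by rw [← mul_pow]; simp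
  have hUT : U = 2 ^ n * T := by
    have h1 := two_pow_mul_factorial_mul_prod_odd n
    have h2 := Nat.choose_mul_factorial_mul_factorial (show n ≤ 2 * n by omega)
    rw [show 2 * n - n = n by omega, ← h1] at h2
    have h3 : ((2 * n).choose n : ℤ) * n.factorial * n.factorial =
      2 ^ n * n.factorial * ∏ i ∈ range n, (2 * (i : ℤ) + 1) := by exact_mod_cast h2
    rw [hc, ← hodd] at h3
    apply mul_right_cancel₀ hn0
    linear_combination (-1) ^ n * h3 + (2 ^ n * n.factorial * T - U * n.factorial) * hs
  have key := pow_three_dvd_prod_sq_sub hp hpn hn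
  rw [prod_mul_distrib, prod_mul_distrib, prod_const, card_range, hfac, ← hT, ← hU, hUT] at key
  have hpi := Nat.prime_iff_prime_int.mp hp
  have hTp : IsCoprime ((p : ℤ) ^ 3) T := by
    refine (IsCoprime.prod_right fun i hi => ?_).pow_left
    rw [hpi.coprime_iff_not_dvd]
    intro h
    have h' : (p : ℤ) ∣ ((2 * (i + 1) : ℕ) : ℤ) := by
      have := dvd_add h (dvd_refl (p : ℤ)); simpa using this
    have := Nat.le_of_dvd (by omega) (Int.natCast_dvd_natCast.mp h')
    simp at hi
    omega
  have hFp : IsCoprime ((p : ℤ) ^ 3) n.factorial := by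
    refine IsCoprime.pow_left ?_
    rw [hpi.coprime_iff_not_dvd, Int.natCast_dvd_natCast, hp.dvd_factorial]
    omega
  have h8 : (p : ℤ) ^ 3 ∣ T - 8 ^ n * n.factorial := by
    refine hTp.dvd_of_dvd_mul_left ?_
    refine key.trans (dvd_of_eq ?_)
    rw [show (8 : ℤ) = 4 * 2 by norm_num, mul_pow]; ring
  refine hFp.dvd_of_dvd_mul_right ?_
  rw [sub_mul, hc, hUT]
  refine (h8.mul_left ((-1) ^ n * 2 ^ n)).trans (dvd_of_eq ?_)
  rw [show (16 : ℤ) = 2 * 8 by norm_num, mul_pow]; ring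

/-- Lemma 2.2 (Mao): for any prime `p > 3`,
`2^{(9p-9)/2} ∑_{k=0}^{(p-3)/2} C((p-1)/2,2k) C(2k,k) / 4^k
  ≡ (-1)^{(p-1)/2} (1 + 6p q_p(2) + 15p² q_p(2)²) (mod p³)`,
where `q_p(2) = (2^{p-1}-1)/p` is the Fermat quotient. -/
theorem pow_mul_sum_choose_congr (p : ℕ) (hp : p.Prime) (hp3 : 3 < p) :
    ((p : ℤ)) ^ 3 ∣
      (2 ^ ((9 * p - 9) / 2) *
          (∑ k ∈ Finset.range ((p - 3) / 2 + 1),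
            (((p - 1) / 2).choose (2 * k) : ℚ) * ((2 * k).choose k : ℚ) / 4 ^ k) -
        (-1) ^ ((p - 1) / 2) *
          (1 + 6 * (p : ℚ) * ((2 ^ (p - 1) - 1) / (p : ℚ)) +
            15 * (p : ℚ) ^ 2 * ((2 ^ (p - 1) - 1) / (p : ℚ)) ^ 2)).num := by
  obtain ⟨n, rfl⟩ : ∃ n, p = 2 * n + 1 := hp.odd_of_ne_two (by omega)
  have hn : 1 < n := by omega
  obtain ⟨d, hd⟩ := morley_congruence hp rfl hn
  have hp0 : ((2 * n + 1 : ℕ) : ℚ) ≠ 0 := by positivity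
  obtain ⟨q, hq⟩ : ((2 * n + 1 : ℕ) : ℤ) ∣ 2 ^ (2 * n) - 1 := by
    have h := Int.ModEq.pow_card_sub_one_eq_one hp (n := 2) <| by
      rw [Int.isCoprime_iff_gcd_eq_one]
      simp [Int.gcd_def]
    simpa using h.symm.dvd
  have hqQ : ((2 : ℚ) ^ (2 * n) - 1) / ((2 * n + 1 : ℕ) : ℚ) = q := by
    rw [div_eq_iff hp0, mul_comm (q : ℚ)]
    exact_mod_cast hq
  rw [show (9 * (2 * n + 1) - 9) / 2 = 8 * n + n by omega,
    show (2 * n + 1 - 3) / 2 + 1 = n by omega, show (2 * n + 1 - 1) / 2 = n by omega,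
    show 2 * n + 1 - 1 = 2 * n by omega, sum_choose_mul_choose_div_four_pow (by omega), hqQ,
    pow_add, mul_assoc, mul_div_cancel₀ _ (by positivity)]
  set p : ℕ := 2 * n + 1
  have hcast : (2 : ℚ) ^ (8 * n) * ((2 * n).choose n : ℚ) -
      (-1) ^ n * (1 + 6 * (p : ℚ) * q + 15 * (p : ℚ) ^ 2 * (q : ℚ) ^ 2) =
      (((2 : ℤ) ^ (8 * n) * ((2 * n).choose n : ℤ) -
      (-1) ^ n * (1 + 6 * (p : ℤ) * q + 15 * (p : ℤ) ^ 2 * q ^ 2) : ℤ) : ℚ) := by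
    push_cast; ring
  rw [hcast, Rat.num_intCast]
  have hpow : 1 + (p : ℤ) * q = 2 ^ (2 * n) := by rw [← hq]; ring
  have h16 : (16 : ℤ) ^ n = (1 + p * q) ^ 2 := by
    rw [hpow, show (16 : ℤ) = 2 ^ 4 by norm_num, ← pow_mul, ← pow_mul]; congr 1; ring
  have h256 : (2 : ℤ) ^ (8 * n) = (1 + p * q) ^ 4 := by
    rw [hpow, ← pow_mul]; congr 1; ring
  rw [h16] at hd
  rw [h256]
  refine ⟨(1 + p * q) ^ 4 * d +
    (-1) ^ n * (20 * q ^ 3 + 15 * p * q ^ 4 + 6 * p ^ 2 * q ^ 5 + p ^ 3 * q ^ 6), ?_⟩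
  linear_combination (1 + (p : ℤ) * q) ^ 4 * hd
end
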